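/- arXiv:1603.01172 — 6 statements merged into one kernel-verified Lean document; each statement's English description precedes it below -/
import Mathlib

section
/- Let 0 < β < 1/2 and t > 0, and set F(c) = ∫_0^t E_β(-c s^β)² ds for c > 0. Then (i) F(c) ≤ Γ(1+β)² · t^{1−2β} / ((1−2β)·c²) for every c > 0, and (ii) lim_{c → ∞} c² · F(c) = t^{1−2β} / ((1−2β)·Γ(1−β)²). In particular, for fixed t, F(c) is asymptotically equivalent to t^{1−2β}·c^{-2}/((1−2β)Γ(1−β)²) as c → ∞. -/
open MeasureTheory Real Filter Asymptotics

/-- The Mittag-Leffler function `E_β(z) = ∑ₖ zᵏ / Γ(1 + βk)`. -/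
noncomputable def mittagLeffler (β z : ℝ) : ℝ :=
  ∑' k : ℕ, z ^ k / Real.Gamma (1 + β * k)


lemma ml_gamma_integrable {σ : ℝ} (hσ : 0 < σ) :
    Integrable (fun r : ℝ => Real.exp (-Real.exp r + σ * r)) := by
  have h := (integrableOn_image_iff_integrableOn_abs_deriv_smul (MeasurableSet.univ)
    (fun x _ => (Real.hasDerivAt_exp x).hasDerivWithinAt)
    (fun x _ y _ hxy => Real.exp_injective hxy) (fun x : ℝ => Real.exp (-x) * x ^ (σ - 1))).1
    (by rw [Set.image_univ, Real.range_exp]; exact Real.GammaIntegral_convergent hσ)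
  rw [integrableOn_univ] at h
  refine h.congr (Eventually.of_forall fun r => ?_)
  simp only [abs_of_pos (Real.exp_pos _), smul_eq_mul]
  rw [← Real.exp_mul, ← Real.exp_add, ← Real.exp_add]
  congr 1; ring

lemma ml_gamma_integral {σ : ℝ} (hσ : 0 < σ) :
    ∫ r : ℝ, Real.exp (-Real.exp r + σ * r) = Real.Gamma σ := by
  have h := integral_image_eq_integral_abs_deriv_smul (MeasurableSet.univ)
    (fun x _ => (Real.hasDerivAt_exp x).hasDerivWithinAt)
    (fun x _ y _ hxy => Real.exp_injective hxy) (fun x : ℝ => Real.exp (-x) * x ^ (σ - 1))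
  rw [Set.image_univ, Real.range_exp, ← Real.Gamma_eq_integral hσ, setIntegral_univ] at h
  rw [h]
  refine integral_congr_ae (Eventually.of_forall fun r => ?_)
  simp only [abs_of_pos (Real.exp_pos _), smul_eq_mul]
  rw [← Real.exp_mul, ← Real.exp_add, ← Real.exp_add]
  congr 1; ring

lemma ml_gamma_integrableOn (σ a : ℝ) :
    IntegrableOn (fun r : ℝ => Real.exp (-Real.exp r + σ * r)) (Set.Ioi a) := by
  by_cases hσ : 0 < σ
  · exact (ml_gamma_integrable hσ).integrableOn
  · have h := ((ml_gamma_integrable (σ := 1) one_pos).integrableOn (s := Set.Ioi a)).const_mul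
      (Real.exp ((σ - 1) * a))
    refine h.mono' (Continuous.aestronglyMeasurable (by fun_prop)) ?_
    filter_upwards [ae_restrict_mem measurableSet_Ioi] with r hr
    rw [Real.norm_eq_abs, abs_of_pos (Real.exp_pos _), ← Real.exp_add]
    apply Real.exp_le_exp.2
    have : a < r := hr
    nlinarith

/-- Hankel type contour integral in logarithmic coordinates. -/
noncomputable def mlHa (a : ℝ) (f : ℂ → ℂ) : ℂ :=
  (∫ r in Set.Ioi a, (f (r + π * Complex.I) - f (r - π * Complex.I))) +
    Complex.I * ∫ y in (-π)..π, f (a + y * Complex.I)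

lemma ml_exp_re_top (r : ℝ) : (Complex.exp (r + π * Complex.I)).re = - Real.exp r := by
  rw [Complex.exp_add_pi_mul_I, Complex.neg_re, Complex.exp_ofReal_re]

lemma ml_exp_re_bot (r : ℝ) : (Complex.exp (r - π * Complex.I)).re = - Real.exp r := by
  rw [Complex.exp_sub_pi_mul_I, Complex.neg_re, Complex.exp_ofReal_re]

lemma ml_collapse (f : ℂ → ℂ) (C σ a : ℝ) (hσ : 0 < σ)
    (hd : ∀ w : ℂ, |w.im| ≤ π → DifferentiableAt ℂ f w)
    (hb : ∀ w : ℂ, |w.im| ≤ π → ‖f w‖ ≤ C * Real.exp ((Complex.exp w).re + σ * w.re)) :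
    mlHa a f = ∫ r : ℝ, (f (r + π * Complex.I) - f (r - π * Complex.I)) := by
  have hpi := Real.pi_pos
  have ct : Continuous fun r : ℝ => f (r + π * Complex.I) := by
    rw [continuous_iff_continuousAt]
    intro r
    have := (hd (r + π * Complex.I) (by simp [abs_of_pos hpi])).continuousAt
    exact ContinuousAt.comp (f := fun r : ℝ => (r + π * Complex.I : ℂ)) this (by fun_prop)
  have cb : Continuous fun r : ℝ => f (r - π * Complex.I) := by
    rw [continuous_iff_continuousAt]
    intro r
    have := (hd (r - π * Complex.I) (by simp [abs_of_pos hpi])).continuousAt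
    exact ContinuousAt.comp (f := fun r : ℝ => (r - π * Complex.I : ℂ)) this (by fun_prop)
  have it : Integrable fun r : ℝ => f (r + π * Complex.I) := by
    refine ((ml_gamma_integrable hσ).const_mul C).mono' ct.aestronglyMeasurable
      (Eventually.of_forall fun r => ?_)
    have := hb (r + π * Complex.I) (by simp [abs_of_pos hpi])
    rw [ml_exp_re_top] at this
    simpa using this
  have ib : Integrable fun r : ℝ => f (r - π * Complex.I) := by
    refine ((ml_gamma_integrable hσ).const_mul C).mono' cb.aestronglyMeasurable
      (Eventually.of_forall fun r => ?_)
    have := hb (r - π * Complex.I) (by simp [abs_of_pos hpi])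
    rw [ml_exp_re_bot] at this
    simpa using this
  have iD := it.sub ib
  set D : ℝ → ℂ := fun r => f (r + π * Complex.I) - f (r - π * Complex.I) with hD
  let V : ℝ → ℂ := fun a => ∫ y in (-π)..π, f (a + y * Complex.I)
  have key : ∀ a' : ℝ, Complex.I * V a = (∫ r in a'..a, D r) + Complex.I * V a' := by
    intro a'
    have h := Complex.integral_boundary_rect_eq_zero_of_differentiableOn f
      (a' + (-π : ℝ) * Complex.I) (a + (π : ℝ) * Complex.I) (by
        intro w hw
        apply (hd w _).differentiableWithinAt
        rw [Complex.mem_reProdIm] at hw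
        have := hw.2
        simp only [Complex.add_im, Complex.ofReal_im, Complex.mul_im, Complex.ofReal_re,
          Complex.I_im, Complex.I_re, mul_one, mul_zero, zero_add, add_zero] at this
        rw [Set.uIcc_of_le (by linarith)] at this
        exact abs_le.2 this)
    simp only [Complex.add_im, Complex.ofReal_im, Complex.mul_im, Complex.ofReal_re,
          Complex.I_im, Complex.I_re, mul_one, mul_zero, zero_add, add_zero, Complex.add_re,
          Complex.mul_re, sub_zero, smul_eq_mul] at h
    have e : (∫ r in a'..a, D r) = (∫ r in a'..a, f (r + π * Complex.I)) -
        ∫ r in a'..a, f (r + (-π : ℝ) * Complex.I) := by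
      rw [← intervalIntegral.integral_sub it.intervalIntegrable]
      · simp [hD, sub_eq_add_neg]
      · simpa [sub_eq_add_neg] using ib.intervalIntegrable
    rw [e]
    linear_combination h
  have hV : Tendsto V atBot (nhds 0) := by
    have hg : Tendsto (fun a : ℝ => |C| * Real.exp (Real.exp a + σ * a) * |π - (-π)|) atBot
        (nhds 0) := by
      have h1 : Tendsto (fun a : ℝ => Real.exp a + σ * a) atBot atBot :=
        tendsto_exp_atBot.add_atBot (tendsto_id.const_mul_atBot hσ)
      have := ((tendsto_exp_atBot.comp h1).const_mul |C|).mul_const |π - (-π)|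
      simpa using this
    refine squeeze_zero_norm (fun a => ?_) hg
    apply intervalIntegral.norm_integral_le_of_norm_le_const
    intro y hy
    rw [Set.uIoc_of_le (by linarith)] at hy
    refine (hb _ (by simpa using abs_le.2 ⟨hy.1.le, hy.2⟩)).trans ?_
    refine mul_le_mul (le_abs_self C) ?_ (Real.exp_pos _).le (abs_nonneg _)
    apply Real.exp_le_exp.2
    have : (Complex.exp (a + y * Complex.I)).re ≤ Real.exp a := by
      refine (Complex.re_le_norm _).trans ?_
      rw [Complex.norm_exp]; simp
    simpa using this
  have lim := (intervalIntegral_tendsto_integral_Iic (μ := volume) (f := D) a iD.integrableOn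
    tendsto_id).add (hV.const_mul Complex.I)
  have lim2 : Tendsto (fun a' : ℝ => (∫ r in a'..a, D r) + Complex.I * V a') atBot
      (nhds (Complex.I * V a)) := by
    simp_rw [← key]; exact tendsto_const_nhds
  have e := tendsto_nhds_unique lim2 lim
  rw [mul_zero, add_zero] at e
  change (∫ r in Set.Ioi a, D r) + Complex.I * V a = ∫ r, D r
  rw [e, add_comm]
  exact intervalIntegral.integral_Iic_add_Ioi iD.integrableOn iD.integrableOn

/-- Hankel integrand. -/
noncomputable def mlF (σ : ℝ) (w : ℂ) : ℂ := Complex.exp (Complex.exp w + σ * w)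

lemma mlF_norm (σ : ℝ) (w : ℂ) :
    ‖mlF σ w‖ = Real.exp ((Complex.exp w).re + σ * w.re) := by
  simp [mlF, Complex.norm_exp]

lemma mlF_deriv (σ : ℝ) (w : ℂ) : HasDerivAt (mlF σ) (mlF (σ + 1) w + σ * mlF σ w) w := by
  have h := ((Complex.hasDerivAt_exp w).add ((hasDerivAt_id w).const_mul (σ : ℂ))).cexp
  refine h.congr_deriv ?_
  have : mlF (σ + 1) w = mlF σ w * Complex.exp w := by
    simp only [mlF]
    rw [← Complex.exp_add]; push_cast; ring_nf
  rw [this]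
  simp only [mlF, id]
  simp
  ring

lemma mlF_cont (σ : ℝ) : Continuous (mlF σ) := by
  unfold mlF; fun_prop

lemma mlF_top_norm (σ r : ℝ) : ‖mlF σ (r + π * Complex.I)‖ = Real.exp (-Real.exp r + σ * r) := by
  rw [mlF_norm, ml_exp_re_top]; simp

lemma mlF_bot_norm (σ r : ℝ) : ‖mlF σ (r - π * Complex.I)‖ = Real.exp (-Real.exp r + σ * r) := by
  rw [mlF_norm, ml_exp_re_bot]; simp

lemma mlF_top_int (σ a : ℝ) :
    IntegrableOn (fun r : ℝ => mlF σ (r + π * Complex.I)) (Set.Ioi a) := by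
  refine (ml_gamma_integrableOn σ a).mono' ?_ (Eventually.of_forall fun r => (mlF_top_norm σ r).le)
  exact ((mlF_cont σ).comp (by fun_prop)).aestronglyMeasurable

lemma mlF_bot_int (σ a : ℝ) :
    IntegrableOn (fun r : ℝ => mlF σ (r - π * Complex.I)) (Set.Ioi a) := by
  refine (ml_gamma_integrableOn σ a).mono' ?_ (Eventually.of_forall fun r => (mlF_bot_norm σ r).le)
  exact ((mlF_cont σ).comp (by fun_prop)).aestronglyMeasurable

lemma ml_decay (σ : ℝ) : Tendsto (fun r : ℝ => Real.exp (-Real.exp r + σ * r)) atTop (nhds 0) := by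
  have h := (tendsto_rpow_mul_exp_neg_mul_atTop_nhds_zero σ 1 one_pos).comp Real.tendsto_exp_atTop
  refine h.congr fun r => ?_
  simp only [Function.comp]
  rw [← Real.exp_mul, ← Real.exp_add]
  congr 1; ring

lemma ml_rec (σ a : ℝ) : mlHa a (mlF (σ + 1)) + σ * mlHa a (mlF σ) = 0 := by
  have h1 : ∫ r in Set.Ioi a, (mlF (σ + 1) (r + π * Complex.I) + σ * mlF σ (r + π * Complex.I))
      = 0 - mlF σ (a + π * Complex.I) := by
    refine integral_Ioi_of_hasDerivAt_of_tendsto' (f := fun r : ℝ => mlF σ (r + π * Complex.I))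
      (fun x _ => ?_) ?_ ?_
    · exact HasDerivAt.comp_ofReal (e := fun z => mlF σ (z + π * Complex.I))
        ((mlF_deriv σ _).comp_add_const _ _)
    · exact (mlF_top_int _ _).add ((mlF_top_int _ _).const_mul _)
    · exact squeeze_zero_norm (fun r => (mlF_top_norm σ r).le) (ml_decay σ)
  have h2 : ∫ r in Set.Ioi a, (mlF (σ + 1) (r - π * Complex.I) + σ * mlF σ (r - π * Complex.I))
      = 0 - mlF σ (a - π * Complex.I) := by
    refine integral_Ioi_of_hasDerivAt_of_tendsto' (f := fun r : ℝ => mlF σ (r - π * Complex.I))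
      (fun x _ => ?_) ?_ ?_
    · exact HasDerivAt.comp_ofReal (e := fun z => mlF σ (z - π * Complex.I))
        ((mlF_deriv σ _).comp_sub_const _ _)
    · exact (mlF_bot_int _ _).add ((mlF_bot_int _ _).const_mul _)
    · exact squeeze_zero_norm (fun r => (mlF_bot_norm σ r).le) (ml_decay σ)
  have cv : ∀ τ : ℝ, Continuous fun y : ℝ => mlF τ (a + y * Complex.I) := fun τ =>
    (mlF_cont τ).comp (by fun_prop)
  have h3 : ∫ y in (-π)..π, ((mlF (σ + 1) (a + y * Complex.I) + σ * mlF σ (a + y * Complex.I))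
      * Complex.I) = mlF σ (a + π * Complex.I) - mlF σ (a + (-π : ℝ) * Complex.I) := by
    refine intervalIntegral.integral_eq_sub_of_hasDerivAt
      (f := fun y : ℝ => mlF σ (a + y * Complex.I)) (fun y _ => ?_) ?_
    · refine HasDerivAt.comp_ofReal (e := fun z => mlF σ (a + z * Complex.I)) ?_
      have := (mlF_deriv σ (a + y * Complex.I)).comp (y : ℂ)
        (((hasDerivAt_id (y : ℂ)).mul_const Complex.I).const_add (a : ℂ))
      simpa using! this
    · exact Continuous.intervalIntegrable
        ((((cv _).add (continuous_const.mul (cv _))).mul continuous_const)) _ _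
  rw [integral_add (mlF_top_int _ _) ((mlF_top_int _ _).const_mul _), integral_const_mul] at h1
  rw [integral_add (mlF_bot_int _ _) ((mlF_bot_int _ _).const_mul _), integral_const_mul] at h2
  rw [intervalIntegral.integral_mul_const, intervalIntegral.integral_add
    ((cv _).intervalIntegrable _ _) (((cv _).intervalIntegrable _ _).const_mul _),
    intervalIntegral.integral_const_mul] at h3
  have e : (a + (-π : ℝ) * Complex.I : ℂ) = a - π * Complex.I := by push_cast; ring
  rw [e] at h3
  unfold mlHa
  rw [integral_sub (mlF_top_int _ _) (mlF_bot_int _ _),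
    integral_sub (mlF_top_int _ _) (mlF_bot_int _ _)]
  linear_combination h1 - h2 + h3

lemma mlF_diff (σ r : ℝ) : mlF σ (r + π * Complex.I) - mlF σ (r - π * Complex.I) =
    ((Real.exp (-Real.exp r + σ * r) : ℝ) : ℂ) * (2 * Complex.I * (Real.sin (π * σ) : ℝ)) := by
  have h1 : mlF σ (r + π * Complex.I) =
      ((Real.exp (-Real.exp r + σ * r) : ℝ) : ℂ) * Complex.exp ((π * σ : ℝ) * Complex.I) := by
    simp only [mlF]
    rw [Complex.exp_add_pi_mul_I, Complex.ofReal_exp, ← Complex.exp_add]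
    push_cast; ring_nf
  have h2 : mlF σ (r - π * Complex.I) =
      ((Real.exp (-Real.exp r + σ * r) : ℝ) : ℂ) * Complex.exp (-(π * σ : ℝ) * Complex.I) := by
    simp only [mlF]
    rw [Complex.exp_sub_pi_mul_I, Complex.ofReal_exp, ← Complex.exp_add]
    push_cast; ring_nf
  rw [h1, h2, Complex.ofReal_sin, Complex.sin]
  linear_combination (-((Real.exp (-Real.exp r + σ * r) : ℝ) : ℂ) *
    (Complex.exp (-(π * σ : ℝ) * Complex.I) - Complex.exp ((π * σ : ℝ) * Complex.I))) *
    Complex.I_sq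

lemma ml_hankel_pos (σ a : ℝ) (h0 : 0 < σ) (h1 : σ < 1) :
    mlHa a (mlF σ) = 2 * π * Complex.I / (Real.Gamma (1 - σ) : ℝ) := by
  rw [ml_collapse (mlF σ) 1 σ a h0 (fun w _ => (mlF_deriv σ w).differentiableAt)
    (fun w _ => by rw [mlF_norm, one_mul])]
  simp_rw [mlF_diff]
  rw [integral_mul_const, integral_complex_ofReal, ml_gamma_integral h0]
  have hr := Real.Gamma_mul_Gamma_one_sub σ
  have hs : Real.sin (π * σ) ≠ 0 := (Real.sin_pos_of_pos_of_lt_pi (by positivity)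
    (by nlinarith [Real.pi_pos])).ne'
  have hg : Real.Gamma (1 - σ) ≠ 0 := (Real.Gamma_pos_of_pos (by linarith)).ne'
  rw [eq_div_iff hs] at hr
  have hr' : (Real.Gamma σ : ℂ) * (Real.Gamma (1 - σ) : ℝ) * (Real.sin (π * σ) : ℝ) = (π : ℝ) := by
    exact_mod_cast hr
  rw [eq_div_iff (by exact_mod_cast hg)]
  linear_combination 2 * Complex.I * hr'

lemma ml_hankel_zero (a : ℝ) : mlHa a (mlF 0) = 2 * π * Complex.I := by
  unfold mlHa
  simp_rw [mlF_diff]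
  have h : circleAverage Complex.exp 0 (Real.exp a) = Complex.exp 0 :=
    DiffContOnCl.circleAverage Complex.differentiable_exp.diffContOnCl
  rw [circleAverage_def] at h
  have hp : Function.Periodic (fun θ : ℝ => Complex.exp (circleMap 0 (Real.exp a) θ)) (2 * π) :=
    fun θ => by simp only [periodic_circleMap 0 (Real.exp a) θ]
  have h2 := hp.intervalIntegral_add_eq 0 (-π)
  rw [zero_add, show -π + 2 * π = π by ring] at h2
  rw [h2] at h
  have e : ∀ y : ℝ, mlF 0 (a + y * Complex.I) = Complex.exp (circleMap 0 (Real.exp a) y) := by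
    intro y
    simp [mlF, circleMap, Complex.exp_add]
  simp_rw [e]
  rw [Complex.exp_zero, Complex.real_smul] at h
  have hpi : (π : ℂ) ≠ 0 := by exact_mod_cast Real.pi_ne_zero
  push_cast at h
  field_simp at h
  simp [h]
  ring

lemma ml_hankel_aux (a : ℝ) (n : ℕ) : ∀ σ : ℝ, -(n : ℝ) ≤ σ → σ < 1 →
    mlHa a (mlF σ) = 2 * π * Complex.I / (Real.Gamma (1 - σ) : ℝ) := by
  have base : ∀ σ : ℝ, 0 ≤ σ → σ < 1 →
    mlHa a (mlF σ) = 2 * π * Complex.I / (Real.Gamma (1 - σ) : ℝ) := by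
    intro σ h0 h1
    rcases h0.eq_or_lt with rfl | h0
    · simp [ml_hankel_zero]
    · exact ml_hankel_pos σ a h0 h1
  induction n with
  | zero => intro σ h0 h1; exact base σ (by simpa using h0) h1
  | succ n ih =>
    intro σ h0 h1
    by_cases hσ : 0 ≤ σ
    · exact base σ hσ h1
    push Not at hσ
    push_cast at h0
    have h := ml_rec σ a
    rw [ih (σ + 1) (by linarith) (by linarith)] at h
    have hG : Real.Gamma (1 - σ) = -σ * Real.Gamma (1 - (σ + 1)) := by
      rw [show 1 - σ = -σ + 1 by ring, Real.Gamma_add_one (by linarith)]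
      congr 2; ring
    have hg : (Real.Gamma (1 - (σ + 1)) : ℂ) ≠ 0 := by
      exact_mod_cast (Real.Gamma_pos_of_pos (by linarith : 0 < 1 - (σ + 1))).ne'
    have hs : (σ : ℂ) ≠ 0 := by exact_mod_cast hσ.ne
    rw [hG]
    push_cast
    rw [eq_div_iff (mul_ne_zero (neg_ne_zero.2 hs) hg)]
    rw [div_add' _ _ _ hg, div_eq_zero_iff] at h
    rcases h with h | h
    · linear_combination -h
    · exact absurd h hg

lemma ml_hankel (σ a : ℝ) (h : σ < 1) :
    mlHa a (mlF σ) = 2 * π * Complex.I / (Real.Gamma (1 - σ) : ℝ) := by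
  obtain ⟨n, hn⟩ := exists_nat_ge (-σ)
  exact ml_hankel_aux a n σ (by linarith) h

/-- Generating function integrand. -/
noncomputable def mlG (β x : ℝ) (w : ℂ) : ℂ := mlF β w / (Complex.exp (β * w) + x)

lemma mlG_den (β x : ℝ) (hβ0 : 0 < β) (hβ : β < 1 / 2) (w : ℂ) (hw : |w.im| ≤ π) :
    x ≤ ‖Complex.exp (β * w) + x‖ := by
  refine le_trans ?_ (Complex.re_le_norm _)
  rw [Complex.add_re, Complex.exp_re, Complex.ofReal_re]
  have h : 0 ≤ Real.cos ((β * w : ℂ).im) := by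
    have e : ((β * w : ℂ).im) = β * w.im := by simp
    rw [e]
    have := abs_le.1 hw
    have hp := Real.pi_pos
    apply Real.cos_nonneg_of_neg_pi_div_two_le_of_le <;> nlinarith
  have := mul_nonneg (Real.exp_pos ((β * w : ℂ).re)).le h
  linarith

lemma mlF_pow (β : ℝ) (k : ℕ) (w : ℂ) :
    mlF (-(β * k)) w = Complex.exp (Complex.exp w) * (Complex.exp (-(β * w))) ^ k := by
  rw [mlF, ← Complex.exp_nat_mul, ← Complex.exp_add]
  push_cast; ring_nf

lemma ml_term_bound (β x a : ℝ) (hβ0 : 0 < β) (hx : 0 < x) (ha : x * Real.exp (-(β * a)) ≤ 1 / 2)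
    (w : ℂ) (hw : a ≤ w.re) : ‖-x * Complex.exp (-(β * w))‖ ≤ 1 / 2 := by
  refine le_trans ?_ ha
  rw [norm_mul, norm_neg, Complex.norm_real, Real.norm_eq_abs, abs_of_pos hx, Complex.norm_exp]
  gcongr
  simp
  gcongr

lemma ml_term_norm (β x a : ℝ) (hβ0 : 0 < β) (hx : 0 < x) (ha : x * Real.exp (-(β * a)) ≤ 1 / 2)
    (w : ℂ) (hw : a ≤ w.re) (k : ℕ) :
    ‖(-x : ℂ) ^ k * mlF (-(β * k)) w‖ ≤ (1 / 2) ^ k * Real.exp ((Complex.exp w).re) := by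
  have e : (-x : ℂ) ^ k * mlF (-(β * k)) w =
      (-x * Complex.exp (-(β * w))) ^ k * Complex.exp (Complex.exp w) := by
    rw [mlF_pow]; ring
  rw [e, norm_mul, norm_pow, Complex.norm_exp (Complex.exp w)]
  gcongr
  exact ml_term_bound β x a hβ0 hx ha w hw

lemma ml_term_hasSum (β x a : ℝ) (hβ0 : 0 < β) (hx : 0 < x)
    (ha : x * Real.exp (-(β * a)) ≤ 1 / 2) (w : ℂ) (hw : a ≤ w.re) :
    HasSum (fun k : ℕ => (-x : ℂ) ^ k * mlF (-(β * k)) w) (mlG β x w) := by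
  have hb := ml_term_bound β x a hβ0 hx ha w hw
  have h := (hasSum_geometric_of_norm_lt_one (lt_of_le_of_lt hb (by norm_num))).mul_right
    (Complex.exp (Complex.exp w))
  have hne : 1 - -x * Complex.exp (-(β * w)) ≠ 0 := by
    intro h0
    have : -x * Complex.exp (-(β * w)) = 1 := (sub_eq_zero.1 h0).symm
    rw [this] at hb
    norm_num at hb
  have e2 : mlG β x w = (1 - -x * Complex.exp (-(β * w)))⁻¹ * Complex.exp (Complex.exp w) := by
    have he : Complex.exp (β * w) + x = Complex.exp (β * w) * (1 - -x * Complex.exp (-(β * w))) := by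
      have : Complex.exp (β * w) * Complex.exp (-(β * w)) = 1 := by
        rw [← Complex.exp_add]; simp
      linear_combination -x * this
    rw [mlG, mlF, he, Complex.exp_add]
    field_simp
  rw [e2]
  refine h.congr_fun fun k => ?_
  rw [mlF_pow]; ring

lemma mlHa_hasSum (β x a : ℝ) (hβ0 : 0 < β) (hx : 0 < x)
    (ha : x * Real.exp (-(β * a)) ≤ 1 / 2) :
    HasSum (fun k : ℕ => (-x : ℂ) ^ k * mlHa a (mlF (-(β * k)))) (mlHa a (mlG β x)) := by
  have hs : ∀ c : ℝ, Summable fun k : ℕ => (1 / 2 : ℝ) ^ k * c := fun c =>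
    (summable_geometric_of_lt_one (by norm_num) (by norm_num)).mul_right c
  have h1 : HasSum (fun k : ℕ => ∫ r in Set.Ioi a, ((-x : ℂ) ^ k * mlF (-(β * k)) (r + π * Complex.I)
      - (-x : ℂ) ^ k * mlF (-(β * k)) (r - π * Complex.I)))
      (∫ r in Set.Ioi a, (mlG β x (r + π * Complex.I) - mlG β x (r - π * Complex.I))) := by
    refine hasSum_integral_of_dominated_convergence
      (fun k r => (1 / 2) ^ k * (2 * Real.exp (-Real.exp r + 0 * r))) (fun k => ?_) (fun k => ?_)
      ?_ ?_ ?_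
    · exact Continuous.aestronglyMeasurable
        ((continuous_const.mul ((mlF_cont _).comp (by fun_prop))).sub
        (continuous_const.mul ((mlF_cont _).comp (by fun_prop))))
    · filter_upwards [ae_restrict_mem measurableSet_Ioi] with r hr
      have hr' : a < r := hr
      have t := ml_term_norm β x a hβ0 hx ha (r + π * Complex.I) (by simpa using hr'.le) k
      have b := ml_term_norm β x a hβ0 hx ha (r - π * Complex.I) (by simpa using hr'.le) k
      rw [ml_exp_re_top] at t
      rw [ml_exp_re_bot] at b
      refine (norm_sub_le _ _).trans ?_
      rw [zero_mul, add_zero]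
      linarith
    · exact Eventually.of_forall fun r => hs _
    · simp_rw [tsum_mul_right]
      exact ((ml_gamma_integrableOn 0 a).const_mul 2).const_mul _
    · filter_upwards [ae_restrict_mem measurableSet_Ioi] with r hr
      have hr' : a < r := hr
      exact (ml_term_hasSum β x a hβ0 hx ha (r + π * Complex.I) (by simpa using hr'.le)).sub
        (ml_term_hasSum β x a hβ0 hx ha (r - π * Complex.I) (by simpa using hr'.le))
  have h2 : HasSum (fun k : ℕ => ∫ y in (-π)..π, ((-x : ℂ) ^ k * mlF (-(β * k)) (a + y * Complex.I)))
      (∫ y in (-π)..π, mlG β x (a + y * Complex.I)) := by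
    refine intervalIntegral.hasSum_integral_of_dominated_convergence
      (fun k r => (1 / 2) ^ k * Real.exp (Real.exp a)) (fun k => ?_) (fun k => ?_)
      ?_ ?_ ?_
    · exact Continuous.aestronglyMeasurable
        (continuous_const.mul ((mlF_cont _).comp (by fun_prop)))
    · refine Eventually.of_forall fun y _ => ?_
      refine (ml_term_norm β x a hβ0 hx ha (a + y * Complex.I) (by simp) k).trans ?_
      gcongr
      refine (Complex.re_le_norm _).trans ?_
      rw [Complex.norm_exp]; simp
    · exact Eventually.of_forall fun r _ => hs _
    · exact intervalIntegrable_const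
    · refine Eventually.of_forall fun y _ => ?_
      exact ml_term_hasSum β x a hβ0 hx ha (a + y * Complex.I) (by simp)
  refine (h1.add (h2.mul_left Complex.I)).congr_fun fun k => ?_
  rw [intervalIntegral.integral_const_mul]
  simp_rw [← mul_sub]
  rw [integral_const_mul, mlHa]
  ring

lemma mlG_diff (β x r : ℝ) (hβ0 : 0 < β) (hβ : β < 1 / 2) (hx : 0 < x) :
    mlG β x (r + π * Complex.I) - mlG β x (r - π * Complex.I) =
    (2 * π * Complex.I) * ((Real.sin (π * β) / π * (Real.exp (-Real.exp r + β * r) * (x /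
      (Real.exp (β * r) ^ 2 + 2 * x * Real.exp (β * r) * Real.cos (π * β) + x ^ 2))) : ℝ) : ℂ) := by
  have hpi := Real.pi_pos
  have d1 := mlG_den β x hβ0 hβ (r + π * Complex.I) (by simp [abs_of_pos hpi])
  have d2 := mlG_den β x hβ0 hβ (r - π * Complex.I) (by simp [abs_of_pos hpi])
  have n1 := norm_pos_iff.1 (hx.trans_le d1)
  have n2 := norm_pos_iff.1 (hx.trans_le d2)
  have hc : 0 ≤ Real.cos (π * β) := Real.cos_nonneg_of_neg_pi_div_two_le_of_le
    (by nlinarith) (by nlinarith)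
  have hE := Real.exp_pos (β * r)
  have hden : 0 < Real.exp (β * r) ^ 2 + 2 * x * Real.exp (β * r) * Real.cos (π * β) + x ^ 2 := by
    positivity
  have hden' : (Real.exp (β * r) ^ 2 + 2 * x * Real.exp (β * r) * Real.cos (π * β) + x ^ 2 : ℂ) ≠ 0 := by
    exact_mod_cast hden.ne'
  set u := Complex.exp ((π * β : ℝ) * Complex.I) with hu
  set v := Complex.exp (-(π * β : ℝ) * Complex.I) with hv
  have huv : u * v = 1 := by rw [hu, hv, ← Complex.exp_add]; simp
  have ft : mlF β (r + π * Complex.I) = ((Real.exp (-Real.exp r + β * r) : ℝ) : ℂ) * u := by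
    simp only [mlF]
    rw [Complex.exp_add_pi_mul_I, Complex.ofReal_exp, ← Complex.exp_add]
    push_cast; ring_nf
  have fb : mlF β (r - π * Complex.I) = ((Real.exp (-Real.exp r + β * r) : ℝ) : ℂ) * v := by
    simp only [mlF]
    rw [Complex.exp_sub_pi_mul_I, Complex.ofReal_exp, ← Complex.exp_add]
    push_cast; ring_nf
  have et : Complex.exp (β * (r + π * Complex.I)) = (Real.exp (β * r) : ℝ) * u := by
    rw [Complex.ofReal_exp, ← Complex.exp_add]; push_cast; ring_nf
  have eb : Complex.exp (β * (r - π * Complex.I)) = (Real.exp (β * r) : ℝ) * v := by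
    rw [Complex.ofReal_exp, ← Complex.exp_add]; push_cast; ring_nf
  have hsin : (Real.sin (π * β) : ℂ) = (v - u) * Complex.I / 2 := by
    rw [Complex.ofReal_sin, Complex.sin]
  have hcos : (Real.cos (π * β) : ℂ) = (u + v) / 2 := by
    rw [Complex.ofReal_cos, Complex.cos]
  have hpi' : (π : ℂ) ≠ 0 := by exact_mod_cast hpi.ne'
  rw [mlG, mlG, ft, fb, et, eb]
  rw [et] at n1
  rw [eb] at n2
  push_cast [-Complex.ofReal_exp, -Complex.ofReal_sin, -Complex.ofReal_cos]
  have hq : (Real.exp (β * r) ^ 2 + 2 * x * Real.exp (β * r) * Real.cos (π * β) + x ^ 2 : ℂ) =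
      ((Real.exp (β * r) : ℝ) * u + x) * ((Real.exp (β * r) : ℝ) * v + x) := by
    rw [hcos]
    linear_combination (-(Real.exp (β * r) : ℂ) ^ 2) * huv
  rw [hq, hsin, div_sub_div _ _ n1 n2]
  field_simp
  rw [Complex.I_sq]
  ring

lemma mlG_int (β x : ℝ) (hβ0 : 0 < β) (hβ : β < 1 / 2) (hx : 0 < x) (a : ℝ) :
    mlHa a (mlG β x) = (2 * π * Complex.I) * ((Real.sin (π * β) / π *
      ∫ r : ℝ, Real.exp (-Real.exp r + β * r) * (x /
      (Real.exp (β * r) ^ 2 + 2 * x * Real.exp (β * r) * Real.cos (π * β) + x ^ 2)) : ℝ) : ℂ) := by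
  rw [ml_collapse (mlG β x) (1 / x) β a hβ0]
  · simp_rw [mlG_diff β x _ hβ0 hβ hx]
    rw [integral_const_mul, integral_complex_ofReal, integral_const_mul]
  · intro w hw
    have := norm_pos_iff.1 (hx.trans_le (mlG_den β x hβ0 hβ w hw))
    exact (mlF_deriv β w).differentiableAt.div (by fun_prop) this
  · intro w hw
    rw [mlG, norm_div, mlF_norm, div_mul_eq_mul_div, one_mul]
    exact div_le_div_of_nonneg_left (Real.exp_pos _).le hx (mlG_den β x hβ0 hβ w hw)

lemma ml_hasSum (β x : ℝ) (hβ0 : 0 < β) (hβ : β < 1 / 2) (hx : 0 < x) :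
    HasSum (fun k : ℕ => (-x) ^ k / Real.Gamma (1 + β * k)) (Real.sin (π * β) / π *
      ∫ r : ℝ, Real.exp (-Real.exp r + β * r) * (x /
      (Real.exp (β * r) ^ 2 + 2 * x * Real.exp (β * r) * Real.cos (π * β) + x ^ 2))) := by
  have ha : x * Real.exp (-(β * (Real.log (2 * x) / β))) ≤ 1 / 2 := by
    rw [mul_div_cancel₀ _ hβ0.ne', Real.exp_neg, Real.exp_log (by positivity)]
    apply le_of_eq; field_simp
  have h := mlHa_hasSum β x _ hβ0 hx ha
  rw [mlG_int β x hβ0 hβ hx] at h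
  have hpi' : (2 * π * Complex.I : ℂ) ≠ 0 := by
    simp [Real.pi_ne_zero]
  rw [← Complex.hasSum_ofReal]
  rw [← hasSum_mul_left_iff hpi']
  refine h.congr_fun fun k => ?_
  rw [ml_hankel _ _ (by have : 0 ≤ β * (k : ℝ) := by positivity
                        linarith), sub_neg_eq_add]
  push_cast; ring

lemma ml_eq (β x : ℝ) (hβ0 : 0 < β) (hβ : β < 1 / 2) (hx : 0 < x) :
    x * mittagLeffler β (-x) = Real.sin (π * β) / π *
      ∫ r : ℝ, Real.exp (-Real.exp r + β * r) * (x ^ 2 /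
      (Real.exp (β * r) ^ 2 + 2 * x * Real.exp (β * r) * Real.cos (π * β) + x ^ 2)) := by
  rw [mittagLeffler, (ml_hasSum β x hβ0 hβ hx).tsum_eq, mul_left_comm, ← integral_const_mul]
  congr 1
  refine integral_congr_ae (Eventually.of_forall fun r => ?_)
  ring

lemma ml_const (β : ℝ) (hβ0 : 0 < β) (hβ : β < 1 / 2) :
    Real.sin (π * β) / π * Real.Gamma β = 1 / Real.Gamma (1 - β) := by
  have hr := Real.Gamma_mul_Gamma_one_sub β
  have hpi := Real.pi_pos
  have hs : Real.sin (π * β) ≠ 0 := (Real.sin_pos_of_pos_of_lt_pi (by positivity)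
    (by nlinarith [Real.pi_pos])).ne'
  have hg : Real.Gamma (1 - β) ≠ 0 := (Real.Gamma_pos_of_pos (by linarith)).ne'
  rw [eq_div_iff hs] at hr
  field_simp
  linarith

lemma ml_const_le (β : ℝ) (hβ0 : 0 < β) (hβ : β < 1 / 2) :
    1 / Real.Gamma (1 - β) ≤ Real.Gamma (1 + β) := by
  rw [← ml_const β hβ0 hβ, add_comm, Real.Gamma_add_one hβ0.ne']
  have hg := Real.Gamma_pos_of_pos hβ0
  have := Real.sin_le (x := π * β) (by positivity)
  gcongr
  rw [div_le_iff₀ Real.pi_pos]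
  linarith

lemma ml_cos (β : ℝ) (hβ0 : 0 < β) (hβ : β < 1 / 2) : 0 ≤ Real.cos (π * β) := by
  have hpi := Real.pi_pos
  exact Real.cos_nonneg_of_neg_pi_div_two_le_of_le (by nlinarith) (by nlinarith)

lemma ml_sin (β : ℝ) (hβ0 : 0 < β) (hβ : β < 1 / 2) : 0 ≤ Real.sin (π * β) / π := by
  have hpi := Real.pi_pos
  exact div_nonneg (Real.sin_nonneg_of_nonneg_of_le_pi (by positivity) (by nlinarith)) hpi.le

lemma ml_ker (x E c : ℝ) (hE : 0 < E) (hc : 0 ≤ c) (hx : 0 < x) :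
    0 ≤ x ^ 2 / (E ^ 2 + 2 * x * E * c + x ^ 2) ∧ x ^ 2 / (E ^ 2 + 2 * x * E * c + x ^ 2) ≤ 1 := by
  refine ⟨by positivity, ?_⟩
  rw [div_le_one (by positivity)]
  have : 0 ≤ E ^ 2 + 2 * x * E * c := by positivity
  linarith

lemma ml_bound (β x : ℝ) (hβ0 : 0 < β) (hβ : β < 1 / 2) (hx : 0 < x) :
    0 ≤ x * mittagLeffler β (-x) ∧ x * mittagLeffler β (-x) ≤ 1 / Real.Gamma (1 - β) := by
  have hk := fun r : ℝ => ml_ker x (Real.exp (β * r)) _ (Real.exp_pos _) (ml_cos β hβ0 hβ) hx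
  rw [ml_eq β x hβ0 hβ hx]
  constructor
  · exact mul_nonneg (ml_sin β hβ0 hβ) (integral_nonneg fun r =>
      mul_nonneg (Real.exp_pos _).le (hk r).1)
  · rw [← ml_const β hβ0 hβ, ← ml_gamma_integral hβ0]
    refine mul_le_mul_of_nonneg_left ?_ (ml_sin β hβ0 hβ)
    refine integral_mono_of_nonneg (Eventually.of_forall fun r =>
      mul_nonneg (Real.exp_pos _).le (hk r).1) (ml_gamma_integrable hβ0)
      (Eventually.of_forall fun r => ?_)
    exact mul_le_of_le_one_right (Real.exp_pos _).le (hk r).2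

lemma ml_lim (β : ℝ) (hβ0 : 0 < β) (hβ : β < 1 / 2) :
    Tendsto (fun x => x * mittagLeffler β (-x)) atTop (nhds (1 / Real.Gamma (1 - β))) := by
  have hc := ml_cos β hβ0 hβ
  have h : Tendsto (fun x : ℝ => Real.sin (π * β) / π *
      ∫ r : ℝ, Real.exp (-Real.exp r + β * r) * (x ^ 2 /
      (Real.exp (β * r) ^ 2 + 2 * x * Real.exp (β * r) * Real.cos (π * β) + x ^ 2))) atTop
      (nhds (1 / Real.Gamma (1 - β))) := by
    rw [← ml_const β hβ0 hβ, ← ml_gamma_integral hβ0]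
    refine Tendsto.const_mul _ ?_
    refine tendsto_integral_filter_of_dominated_convergence
      (fun r => Real.exp (-Real.exp r + β * r)) ?_ ?_ (ml_gamma_integrable hβ0) ?_
    · exact Eventually.of_forall fun x => Measurable.aestronglyMeasurable (by fun_prop)
    · filter_upwards [eventually_gt_atTop 0] with x hx
      refine Eventually.of_forall fun r => ?_
      have hk := ml_ker x (Real.exp (β * r)) _ (Real.exp_pos _) hc hx
      rw [Real.norm_eq_abs, abs_of_nonneg (mul_nonneg (Real.exp_pos _).le hk.1)]
      exact mul_le_of_le_one_right (Real.exp_pos _).le hk.2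
    · refine Eventually.of_forall fun r => ?_
      have h1 : Tendsto (fun x : ℝ => 1 / ((Real.exp (β * r) * x⁻¹) ^ 2 +
          2 * (Real.exp (β * r) * x⁻¹) * Real.cos (π * β) + 1)) atTop (nhds 1) := by
        have ht := (tendsto_inv_atTop_zero (𝕜 := ℝ)).const_mul (Real.exp (β * r))
        have := (tendsto_const_nhds (x := (1 : ℝ)) (f := atTop (α := ℝ))).div
          (((ht.pow 2).add ((ht.const_mul 2).mul_const (Real.cos (π * β)))).add_const 1)
          (by norm_num)
        norm_num at this
        refine Tendsto.congr (fun x => ?_) this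
        simp [Pi.div_apply]
      have h2 := h1.const_mul (Real.exp (-Real.exp r + β * r))
      rw [mul_one] at h2
      refine h2.congr' ?_
      filter_upwards [eventually_gt_atTop 0] with x hx
      congr 1
      have := Real.exp_pos (β * r)
      rw [div_eq_div_iff (by positivity) (by positivity)]
      field_simp
  refine h.congr' ?_
  filter_upwards [eventually_gt_atTop 0] with x hx
  rw [ml_eq β x hβ0 hβ hx]

lemma ml_meas (β c t : ℝ) (hβ0 : 0 < β) (hβ : β < 1 / 2) (hc : 0 < c) :
    AEStronglyMeasurable (fun s : ℝ => mittagLeffler β (-c * s ^ β))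
      (volume.restrict (Set.Ioc 0 t)) := by
  refine aestronglyMeasurable_of_tendsto_ae atTop
    (f := fun (n : ℕ) (s : ℝ) => ∑ k ∈ Finset.range n, (-c * s ^ β) ^ k / Real.Gamma (1 + β * k))
    (fun n => Measurable.aestronglyMeasurable (by fun_prop)) ?_
  filter_upwards [ae_restrict_mem measurableSet_Ioc] with s hs
  have hs0 := Real.rpow_pos_of_pos hs.1 β
  have h := (ml_hasSum β (c * s ^ β) hβ0 hβ (by positivity))
  rw [mittagLeffler]
  rw [← neg_mul] at h
  rw [h.tsum_eq]
  exact h.tendsto_sum_nat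

lemma ml_pt (β c s : ℝ) (hβ0 : 0 < β) (hβ : β < 1 / 2) (hc : 0 < c) (hs : 0 < s) :
    c ^ 2 * mittagLeffler β (-c * s ^ β) ^ 2 ≤ (1 / Real.Gamma (1 - β)) ^ 2 * s ^ (-(2 * β)) := by
  have hs0 := Real.rpow_pos_of_pos hs β
  obtain ⟨h0, h1⟩ := ml_bound β (c * s ^ β) hβ0 hβ (by positivity)
  rw [← neg_mul] at h0 h1
  have h2 := pow_le_pow_left₀ h0 h1 2
  have e : s ^ (-(2 * β)) = ((s ^ β) ^ 2)⁻¹ := by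
    rw [Real.rpow_neg hs.le, mul_comm, Real.rpow_mul hs.le, Real.rpow_two]
  rw [e, ← div_eq_mul_inv, le_div_iff₀ (by positivity)]
  calc _ = (c * s ^ β * mittagLeffler β (-c * s ^ β)) ^ 2 := by ring
    _ ≤ _ := h2

lemma ml_bint (β t : ℝ) (hβ : β < 1 / 2) :
    IntervalIntegrable (fun s : ℝ => (1 / Real.Gamma (1 - β)) ^ 2 * s ^ (-(2 * β))) volume 0 t :=
  (intervalIntegral.intervalIntegrable_rpow' (by linarith)).const_mul _

lemma ml_bval (β t : ℝ) (hβ : β < 1 / 2) :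
    ∫ s in (0 : ℝ)..t, (1 / Real.Gamma (1 - β)) ^ 2 * s ^ (-(2 * β)) =
      t ^ (1 - 2 * β) / ((1 - 2 * β) * Real.Gamma (1 - β) ^ 2) := by
  rw [intervalIntegral.integral_const_mul, integral_rpow (Or.inl (by linarith)),
    show -(2 * β) + 1 = 1 - 2 * β by ring, Real.zero_rpow (by linarith)]
  rw [sub_zero, div_pow, one_pow, mul_comm (1 - 2 * β), div_mul_div_comm, one_mul]
/-- For `0 < β < 1/2` and `F(c) = ∫₀^t E_β(−c s^β)² ds`:
(i) `F(c) ≤ Γ(1+β)² t^{1−2β} / ((1−2β) c²)`;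
(ii) `c² F(c) → t^{1−2β}/((1−2β) Γ(1−β)²)` as `c → ∞`; in particular
`F(c) ∼ t^{1−2β} c^{-2} / ((1−2β) Γ(1−β)²)`. -/
theorem spide_spatial_spectral_density_asymptotics
    (β t : ℝ) (hβ0 : 0 < β) (hβ : β < 1 / 2) (ht : 0 < t)
    (F : ℝ → ℝ)
    (hF : ∀ c : ℝ, 0 < c →
      F c = ∫ s in (0 : ℝ)..t, (mittagLeffler β (-c * s ^ β)) ^ 2) :
    (∀ c : ℝ, 0 < c →
      F c ≤ Real.Gamma (1 + β) ^ 2 * t ^ (1 - 2 * β) / ((1 - 2 * β) * c ^ 2)) ∧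
    Tendsto (fun c : ℝ => c ^ 2 * F c) atTop
      (nhds (t ^ (1 - 2 * β) / ((1 - 2 * β) * Real.Gamma (1 - β) ^ 2))) ∧
    F ~[atTop]
      (fun c : ℝ => t ^ (1 - 2 * β) * c ^ (-(2 : ℝ)) /
        ((1 - 2 * β) * Real.Gamma (1 - β) ^ 2)) := by
  have hg : 0 < Real.Gamma (1 - β) := Real.Gamma_pos_of_pos (by linarith)
  have hb : 0 < 1 - 2 * β := by linarith
  have htp : 0 < t ^ (1 - 2 * β) := Real.rpow_pos_of_pos ht _
  have hle : ∀ c : ℝ, 0 < c → c ^ 2 * F c ≤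
      t ^ (1 - 2 * β) / ((1 - 2 * β) * Real.Gamma (1 - β) ^ 2) := by
    intro c hc
    rw [hF c hc, ← intervalIntegral.integral_const_mul, ← ml_bval β t hβ,
      intervalIntegral.integral_of_le ht.le, intervalIntegral.integral_of_le ht.le]
    refine integral_mono_of_nonneg (Eventually.of_forall fun s => by
      simp only [Pi.zero_apply]; positivity)
      ((intervalIntegrable_iff_integrableOn_Ioc_of_le ht.le).1 (ml_bint β t hβ)) ?_
    filter_upwards [ae_restrict_mem measurableSet_Ioc] with s hs
    exact ml_pt β c s hβ0 hβ hc hs.1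
  have hlim : Tendsto (fun c : ℝ => c ^ 2 * F c) atTop
      (nhds (t ^ (1 - 2 * β) / ((1 - 2 * β) * Real.Gamma (1 - β) ^ 2))) := by
    have h : Tendsto (fun c : ℝ => ∫ s in (0 : ℝ)..t, c ^ 2 * mittagLeffler β (-c * s ^ β) ^ 2)
        atTop (nhds (t ^ (1 - 2 * β) / ((1 - 2 * β) * Real.Gamma (1 - β) ^ 2))) := by
      rw [← ml_bval β t hβ]
      refine intervalIntegral.tendsto_integral_filter_of_dominated_convergence
        (fun s : ℝ => (1 / Real.Gamma (1 - β)) ^ 2 * s ^ (-(2 * β))) ?_ ?_ (ml_bint β t hβ) ?_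
      · filter_upwards [eventually_gt_atTop 0] with c hc
        rw [Set.uIoc_of_le ht.le]
        exact ((ml_meas β c t hβ0 hβ hc).pow 2).const_mul _
      · filter_upwards [eventually_gt_atTop 0] with c hc
        refine Eventually.of_forall fun s hs => ?_
        rw [Set.uIoc_of_le ht.le] at hs
        rw [Real.norm_eq_abs, abs_of_nonneg (by positivity)]
        exact ml_pt β c s hβ0 hβ hc hs.1
      · refine Eventually.of_forall fun s hs => ?_
        rw [Set.uIoc_of_le ht.le] at hs
        have hs0 := Real.rpow_pos_of_pos hs.1 β
        have e : s ^ (-(2 * β)) = ((s ^ β) ^ 2)⁻¹ := by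
          rw [Real.rpow_neg hs.1.le, mul_comm, Real.rpow_mul hs.1.le, Real.rpow_two]
        rw [e]
        have h1 := (((ml_lim β hβ0 hβ).comp (tendsto_id.atTop_mul_const hs0)).pow 2).mul_const
          (((s ^ β) ^ 2)⁻¹)
        refine h1.congr fun c => ?_
        simp only [Function.comp, id]
        rw [← neg_mul]
        field_simp
    refine h.congr' ?_
    filter_upwards [eventually_gt_atTop 0] with c hc
    rw [hF c hc, intervalIntegral.integral_const_mul]
  refine ⟨fun c hc => ?_, hlim, ?_⟩
  · have h1 := hle c hc
    have h2 := pow_le_pow_left₀ (by positivity) (ml_const_le β hβ0 hβ) 2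
    have h3 : t ^ (1 - 2 * β) / ((1 - 2 * β) * Real.Gamma (1 - β) ^ 2) ≤
        Real.Gamma (1 + β) ^ 2 * (t ^ (1 - 2 * β) / (1 - 2 * β)) := by
      refine le_trans (le_of_eq ?_) (mul_le_mul_of_nonneg_right h2 (by positivity))
      field_simp
    rw [le_div_iff₀ (by positivity)]
    have h4 := mul_le_mul_of_nonneg_right (h1.trans h3) hb.le
    calc F c * ((1 - 2 * β) * c ^ 2) = c ^ 2 * F c * (1 - 2 * β) := by ring
      _ ≤ _ := h4
      _ = _ := by rw [mul_assoc, div_mul_cancel₀ _ hb.ne']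
  · rw [isEquivalent_iff_tendsto_one]
    · have h := hlim.div_const (t ^ (1 - 2 * β) / ((1 - 2 * β) * Real.Gamma (1 - β) ^ 2))
      rw [div_self (by positivity)] at h
      refine h.congr' ?_
      filter_upwards [eventually_gt_atTop 0] with c hc
      simp only [Pi.div_apply]
      rw [Real.rpow_neg hc.le, Real.rpow_two]
      field_simp
    · filter_upwards [eventually_gt_atTop 0] with c hc
      have := Real.rpow_pos_of_pos hc (-(2 : ℝ))
      positivity
end

section
/- Fix t > 0 and for x > 0 define G(x) = ∫_0^t ( exp(r x⁴ / 4) · (2/√π) ∫_{√r x² / 2}^∞ e^{-u²} du )² dr. Then lim_{x → ∞} x⁴ · G(x) / log x = 16/π; in particular there is a finite constant C (depending on t) such that G(x) ≤ C · x^{-4} · log x for all x ≥ 2. -/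
open MeasureTheory Real Filter

namespace Btbm

noncomputable def T (z : ℝ) : ℝ := ∫ u in Set.Ioi z, Real.exp (-u ^ 2)

lemma integ : Integrable (fun u : ℝ => Real.exp (-u ^ 2)) := by
  simpa using integrable_exp_neg_mul_sq (b := 1) one_pos

lemma T_eq (z : ℝ) : T z = T 0 - ∫ u in (0:ℝ)..z, Real.exp (-u ^ 2) := by
  have := intervalIntegral.integral_Ioi_sub_Ioi' (a := 0) (b := z) (f := fun u : ℝ => Real.exp (-u ^ 2))
    integ.integrableOn integ.integrableOn
  unfold T
  linarith

lemma T_deriv (z : ℝ) : HasDerivAt T (-Real.exp (-z ^ 2)) z := by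
  have h : HasDerivAt (fun z => T 0 - ∫ u in (0:ℝ)..z, Real.exp (-u ^ 2)) (-Real.exp (-z ^ 2)) z := by
    have hc : Continuous (fun u : ℝ => Real.exp (-u ^ 2)) := by fun_prop
    simpa using (hc.integral_hasStrictDerivAt 0 z).hasDerivAt.const_sub (T 0)
  have e : T = (fun z => T 0 - ∫ u in (0:ℝ)..z, Real.exp (-u ^ 2)) := funext T_eq
  rw [e]
  simpa only [← T_eq] using h

lemma T_cont : Continuous T := continuous_iff_continuousAt.2 fun z => (T_deriv z).continuousAt

lemma T_nonneg (z : ℝ) : 0 ≤ T z := by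
  unfold T; exact integral_nonneg fun u => (Real.exp_pos _).le

lemma T_lim : Tendsto T atTop (nhds 0) := by
  have h := intervalIntegral_tendsto_integral_Ioi (0:ℝ) (integ.integrableOn (s := Set.Ioi 0)) tendsto_id
  have h2 := h.const_sub (T 0)
  have : T 0 - (∫ u in Set.Ioi (0:ℝ), Real.exp (-u ^ 2)) = 0 := by unfold T; ring
  rw [this] at h2
  exact h2.congr fun z => (T_eq z).symm

lemma nonneg_of_deriv (f f' : ℝ → ℝ) (hd : ∀ z, 0 < z → HasDerivAt f (f' z) z)
    (hn : ∀ z, 0 < z → f' z ≤ 0) (hl : Tendsto f atTop (nhds 0)) (z : ℝ) (hz : 0 < z) : 0 ≤ f z := by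
  have ha : AntitoneOn f (Set.Ioi 0) := by
    apply antitoneOn_of_deriv_nonpos (convex_Ioi 0)
    · exact fun y hy => (hd y hy).continuousAt.continuousWithinAt
    · intro y hy
      rw [interior_Ioi] at hy
      exact (hd y hy).differentiableAt.differentiableWithinAt
    · intro y hy
      rw [interior_Ioi] at hy
      rw [(hd y hy).deriv]; exact hn y hy
  apply le_of_tendsto hl
  filter_upwards [eventually_ge_atTop z] with y hy
  exact ha hz (lt_of_lt_of_le hz hy) hy

lemma exp_deriv (z : ℝ) : HasDerivAt (fun z : ℝ => Real.exp (-z ^ 2)) (Real.exp (-z ^ 2) * (-(2 * z))) z := by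
  have := ((hasDerivAt_pow 2 z).neg).exp
  simpa using this

lemma exp_lim : Tendsto (fun z : ℝ => Real.exp (-z ^ 2)) atTop (nhds 0) := by
  exact Real.tendsto_exp_neg_atTop_nhds_zero.comp (tendsto_pow_atTop (two_ne_zero))

lemma T_upper (z : ℝ) (hz : 0 < z) : T z ≤ Real.exp (-z ^ 2) * (z⁻¹ / 2) := by
  have := nonneg_of_deriv (fun z => Real.exp (-z ^ 2) * (z⁻¹ / 2) - T z)
    (fun z => (Real.exp (-z ^ 2) * (-(2 * z)) * (z⁻¹ / 2) + Real.exp (-z ^ 2) * (-(z ^ 2)⁻¹ / 2)) -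
      (-Real.exp (-z ^ 2)))
    (fun y hy => ((exp_deriv y).mul ((hasDerivAt_inv hy.ne').div_const 2)).sub (T_deriv y)) ?_ ?_ z hz
  · linarith
  · intro y hy
    have : (Real.exp (-y ^ 2) * (-(2 * y)) * (y⁻¹ / 2) + Real.exp (-y ^ 2) * (-(y ^ 2)⁻¹ / 2)) -
      (-Real.exp (-y ^ 2)) = - (Real.exp (-y^2) * (y ^ 2)⁻¹ / 2) := by
      field_simp; ring
    simp only [this]
    have : 0 ≤ (Real.exp (-y^2) * (y ^ 2)⁻¹ / 2) := by positivity
    linarith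
  · simpa using (exp_lim.mul (tendsto_inv_atTop_zero.div_const 2)).sub T_lim

lemma T_lower (z : ℝ) (hz : 0 < z) : Real.exp (-z ^ 2) * (z⁻¹ / 2 - (z⁻¹) ^ 3 / 4) ≤ T z := by
  have := nonneg_of_deriv (fun z => T z - Real.exp (-z ^ 2) * (z⁻¹ / 2 - (z⁻¹) ^ 3 / 4))
    (fun z => -Real.exp (-z ^ 2) - (Real.exp (-z ^ 2) * (-(2 * z)) * (z⁻¹ / 2 - (z⁻¹) ^ 3 / 4)
      + Real.exp (-z ^ 2) * (-(z ^ 2)⁻¹ / 2 - (((3:ℕ):ℝ) * z⁻¹ ^ (3 - 1) * (-(z^2)⁻¹)) / 4)))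
    (fun y hy => (T_deriv y).sub ((exp_deriv y).mul (((hasDerivAt_inv hy.ne').div_const 2).sub
      (((hasDerivAt_inv hy.ne').pow 3).div_const 4)))) ?_ ?_ z hz
  · linarith
  · intro y hy
    have : -Real.exp (-y ^ 2) - (Real.exp (-y ^ 2) * (-(2 * y)) * (y⁻¹ / 2 - (y⁻¹) ^ 3 / 4)
      + Real.exp (-y ^ 2) * (-(y ^ 2)⁻¹ / 2 - (((3:ℕ):ℝ) * y⁻¹ ^ (3 - 1) * (-(y^2)⁻¹)) / 4)) =
      - (Real.exp (-y^2) * (3 / 4) * (y ^ 4)⁻¹) := by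
      norm_num
      field_simp; ring
    simp only [this]
    have : 0 ≤ (Real.exp (-y^2) * (3 / 4) * (y ^ 4)⁻¹) := by positivity
    linarith
  · simpa using T_lim.sub (exp_lim.mul ((tendsto_inv_atTop_zero.div_const 2).sub
      ((tendsto_inv_atTop_zero.pow 3).div_const 4)))

noncomputable def F (s : ℝ) : ℝ := (Real.exp s * (2 / √π * T (√s))) ^ 2

lemma F_cont : Continuous F := by
  have := T_cont
  unfold F
  fun_prop

lemma F_nonneg (s : ℝ) : 0 ≤ F s := sq_nonneg _

lemma F_upper (s : ℝ) (hs : 0 < s) : F s ≤ 1 / π * s⁻¹ := by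
  have hz := Real.sqrt_pos.2 hs
  have hp := Real.sqrt_pos.2 Real.pi_pos
  have h := T_upper _ hz
  rw [Real.sq_sqrt hs.le] at h
  have h1 : Real.exp s * (2 / √π * T (√s)) ≤ (√π)⁻¹ * (√s)⁻¹ := by
    calc _ ≤ Real.exp s * (2 / √π * (Real.exp (-s) * ((√s)⁻¹ / 2))) := by gcongr
      _ = _ := by rw [Real.exp_neg]; field_simp
  have h0 : 0 ≤ Real.exp s * (2 / √π * T (√s)) := by
    have := T_nonneg (√s); positivity
  calc F s ≤ ((√π)⁻¹ * (√s)⁻¹) ^ 2 := pow_le_pow_left₀ h0 h1 2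
    _ = _ := by rw [mul_pow, inv_pow, inv_pow, Real.sq_sqrt hs.le, Real.sq_sqrt Real.pi_pos.le, one_div]

lemma F_lower (s : ℝ) (hs : 1 ≤ s) : 1 / π * (s⁻¹ - (s ^ 2)⁻¹) ≤ F s := by
  have hs0 : 0 < s := by linarith
  have hz := Real.sqrt_pos.2 hs0
  have hp := Real.sqrt_pos.2 Real.pi_pos
  have h := T_lower _ hz
  rw [Real.sq_sqrt hs0.le] at h
  have e3 : (√s)⁻¹ / 2 - ((√s)⁻¹) ^ 3 / 4 = (√s)⁻¹ / 2 * (1 - s⁻¹ / 2) := by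
    have : ((√s)⁻¹) ^ 3 = (√s)⁻¹ * s⁻¹ := by
      rw [pow_succ', inv_pow, Real.sq_sqrt hs0.le]
    rw [this]; ring
  rw [e3] at h
  have hi : s⁻¹ ≤ 1 := inv_le_one_of_one_le₀ hs
  have h1 : (√π)⁻¹ * (√s)⁻¹ * (1 - s⁻¹ / 2) ≤ Real.exp s * (2 / √π * T (√s)) := by
    calc _ = Real.exp s * (2 / √π * (Real.exp (-s) * ((√s)⁻¹ / 2 * (1 - s⁻¹ / 2)))) := by
          rw [Real.exp_neg]; field_simp
      _ ≤ _ := by gcongr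
  have h0 : 0 ≤ (√π)⁻¹ * (√s)⁻¹ * (1 - s⁻¹ / 2) := by
    have : 0 ≤ 1 - s⁻¹ / 2 := by linarith
    positivity
  have h2 := pow_le_pow_left₀ h0 h1 2
  refine le_trans ?_ h2
  rw [mul_pow, mul_pow, inv_pow, inv_pow, Real.sq_sqrt hs0.le, Real.sq_sqrt Real.pi_pos.le, one_div,
    mul_assoc]
  have hpi : 0 ≤ π⁻¹ := by positivity
  apply mul_le_mul_of_nonneg_left _ hpi
  have : 0 ≤ s⁻¹ := by positivity
  rw [← inv_pow]
  nlinarith [mul_nonneg this (sq_nonneg (s⁻¹))]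

noncomputable def H (A : ℝ) : ℝ := ∫ s in (0:ℝ)..A, F s

lemma F_ii (a b : ℝ) : IntervalIntegrable F volume a b := F_cont.intervalIntegrable a b

lemma H_split (A B : ℝ) : H B = H A + ∫ s in A..B, F s :=
  (intervalIntegral.integral_add_adjacent_intervals (F_ii 0 A) (F_ii A B)).symm

lemma H_mono {A B : ℝ} (h : A ≤ B) : H A ≤ H B := by
  rw [H_split A B]
  have := intervalIntegral.integral_nonneg (μ := volume) h (fun u _ => F_nonneg u)
  linarith

lemma inv_ii (A : ℝ) (hA : 1 ≤ A) : IntervalIntegrable (fun s : ℝ => s⁻¹) volume 1 A := by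
  apply ContinuousOn.intervalIntegrable
  intro s hs
  rw [Set.uIcc_of_le hA] at hs
  exact (continuousAt_inv₀ (by linarith [hs.1])).continuousWithinAt

lemma inv2_ii (A : ℝ) (hA : 1 ≤ A) : IntervalIntegrable (fun s : ℝ => (s ^ 2)⁻¹) volume 1 A := by
  apply ContinuousOn.intervalIntegrable
  intro s hs
  rw [Set.uIcc_of_le hA] at hs
  have : s ≠ 0 := by linarith [hs.1]
  exact ContinuousAt.continuousWithinAt (by fun_prop (disch := positivity))

lemma H_upper (A : ℝ) (hA : 1 ≤ A) : H A ≤ H 1 + 1 / π * Real.log A := by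
  rw [H_split 1 A]
  have : ∫ s in (1:ℝ)..A, F s ≤ ∫ s in (1:ℝ)..A, 1 / π * s⁻¹ := by
    apply intervalIntegral.integral_mono_on hA (F_ii _ _) ((inv_ii A hA).const_mul _)
    intro s hs
    exact F_upper s (by linarith [hs.1])
  rw [intervalIntegral.integral_const_mul, integral_inv_of_pos one_pos (by linarith), div_one] at this
  linarith

lemma H_lower (A : ℝ) (hA : 1 ≤ A) : 1 / π * (Real.log A - 1) ≤ H A := by
  have h1 : 0 ≤ H 1 := intervalIntegral.integral_nonneg (by norm_num) (fun u _ => F_nonneg u)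
  rw [H_split 1 A]
  have : ∫ s in (1:ℝ)..A, 1 / π * (s⁻¹ - (s ^ 2)⁻¹) ≤ ∫ s in (1:ℝ)..A, F s := by
    apply intervalIntegral.integral_mono_on hA
      (((inv_ii A hA).sub (inv2_ii A hA)).const_mul _) (F_ii _ _)
    intro s hs
    exact F_lower s hs.1
  have h2 : ∫ s in (1:ℝ)..A, (s ^ 2)⁻¹ = 1 - A⁻¹ := by
    have := intervalIntegral.integral_eq_sub_of_hasDerivAt (a := 1) (b := A)
      (f := fun s : ℝ => - s⁻¹) (f' := fun s => (s^2)⁻¹) ?_ (inv2_ii A hA)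
    · rw [this]; norm_num; ring
    · intro s hs
      rw [Set.uIcc_of_le hA] at hs
      have : s ≠ 0 := by linarith [hs.1]
      have h5 := (hasDerivAt_inv this).neg
      rw [neg_neg] at h5
      exact h5
  rw [intervalIntegral.integral_const_mul, intervalIntegral.integral_sub (inv_ii A hA) (inv2_ii A hA),
    integral_inv_of_pos one_pos (by linarith), div_one, h2] at this
  have h3 : 0 ≤ A⁻¹ := by positivity
  have h4 : 1 / π * (Real.log A - 1) ≤ 1 / π * (Real.log A - (1 - A⁻¹)) := by
    gcongr; linarith
  linarith

lemma G_eq (t x : ℝ) (hx : 0 < x) : (∫ r in (0 : ℝ)..t,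
        (Real.exp (r * x ^ 4 / 4) *
          ((2 / Real.sqrt π) *
            ∫ u in Set.Ioi (Real.sqrt r * x ^ 2 / 2), Real.exp (-u ^ 2))) ^ 2) =
    4 * (x ^ 4)⁻¹ * H (t / 4 * x ^ 4) := by
  have h : ∀ r : ℝ, (Real.exp (r * x ^ 4 / 4) *
          ((2 / Real.sqrt π) *
            ∫ u in Set.Ioi (Real.sqrt r * x ^ 2 / 2), Real.exp (-u ^ 2))) ^ 2 = F (r * (x ^ 4 / 4)) := by
    intro r
    have : √(r * (x ^ 4 / 4)) = √r * x ^ 2 / 2 := by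
      rw [Real.sqrt_mul' _ (by positivity), show x ^ 4 / 4 = (x ^ 2 / 2) ^ 2 by ring,
        Real.sqrt_sq (by positivity)]
      ring
    unfold F T
    rw [this, mul_div_assoc]
  simp only [h]
  rw [intervalIntegral.integral_comp_mul_right F (by positivity)]
  unfold H
  rw [zero_mul, smul_eq_mul, show t * (x ^ 4 / 4) = t / 4 * x ^ 4 by ring]
  congr 1
  field_simp

end Btbm

open Btbm

/-- Logarithmic spectral asymptotics at the critical fraction `β = 1/2`: for
`G(x) = ∫₀^t (e^{r x⁴/4} (2/√π) ∫_{√r x²/2}^∞ e^{-u²} du)² dr` one has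
`x⁴ G(x)/log x → 16/π` as `x → ∞`; in particular `G(x) ≤ C x^{-4} log x` for `x ≥ 2`. -/
theorem btbm_spide_spectral_log_asymptotics
    (t : ℝ) (ht : 0 < t)
    (G : ℝ → ℝ)
    (hG : ∀ x : ℝ, 0 < x →
      G x = ∫ r in (0 : ℝ)..t,
        (Real.exp (r * x ^ 4 / 4) *
          ((2 / Real.sqrt π) *
            ∫ u in Set.Ioi (Real.sqrt r * x ^ 2 / 2), Real.exp (-u ^ 2))) ^ 2) :
    Tendsto (fun x : ℝ => x ^ 4 * G x / Real.log x) atTop (nhds (16 / π)) ∧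
    ∃ C : ℝ, ∀ x : ℝ, 2 ≤ x → G x ≤ C * x ^ (-(4 : ℝ)) * Real.log x := by
  have hG' : ∀ x, 0 < x → G x = 4 * (x ^ 4)⁻¹ * H (t / 4 * x ^ 4) := fun x hx => by
    rw [hG x hx, G_eq t x hx]
  have hlogm : ∀ a x : ℝ, 0 < a → 0 < x → Real.log (a * x ^ 4) = Real.log a + 4 * Real.log x := by
    intro a x ha hx
    rw [Real.log_mul ha.ne' (by positivity), Real.log_pow]; norm_num
  have hpi := Real.pi_pos
  constructor
  · have hinv : Tendsto (fun x : ℝ => (Real.log x)⁻¹) atTop (nhds 0) :=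
      tendsto_inv_atTop_zero.comp Real.tendsto_log_atTop
    have hA : ∀ᶠ x : ℝ in atTop, 1 ≤ t / 4 * x ^ 4 :=
      ((tendsto_pow_atTop (α := ℝ) (n := 4) (by norm_num)).const_mul_atTop
        (by positivity : 0 < t / 4)).eventually_ge_atTop 1
    have hlim : ∀ c : ℝ, Tendsto (fun x : ℝ => 16 / π + c * (Real.log x)⁻¹) atTop (nhds (16 / π)) := by
      intro c
      simpa using (hinv.const_mul c).const_add (16 / π)
    refine tendsto_of_tendsto_of_tendsto_of_le_of_le'
      (hlim (4 / π * (Real.log (t / 4) - 1))) (hlim (4 * H 1 + 4 / π * Real.log (t / 4))) ?_ ?_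
    · filter_upwards [hA, eventually_gt_atTop 1] with x h1 hx
      have hx0 : 0 < x := by linarith
      have hl := Real.log_pos hx
      have := H_lower _ h1
      rw [hlogm _ _ (by positivity) hx0] at this
      rw [hG' x hx0, le_div_iff₀ hl]
      have e : x ^ 4 * (4 * (x ^ 4)⁻¹ * H (t / 4 * x ^ 4)) = 4 * H (t / 4 * x ^ 4) := by
        field_simp
      rw [e]
      have e2 : (16 / π + 4 / π * (Real.log (t / 4) - 1) * (Real.log x)⁻¹) * Real.log x =
        4 * (1 / π * (Real.log (t / 4) + 4 * Real.log x - 1)) := by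
        field_simp; ring
      rw [e2]; linarith
    · filter_upwards [hA, eventually_gt_atTop 1] with x h1 hx
      have hx0 : 0 < x := by linarith
      have hl := Real.log_pos hx
      have := H_upper _ h1
      rw [hlogm _ _ (by positivity) hx0] at this
      rw [hG' x hx0, div_le_iff₀ hl]
      have e : x ^ 4 * (4 * (x ^ 4)⁻¹ * H (t / 4 * x ^ 4)) = 4 * H (t / 4 * x ^ 4) := by
        field_simp
      rw [e]
      have e2 : (16 / π + (4 * H 1 + 4 / π * Real.log (t / 4)) * (Real.log x)⁻¹) * Real.log x =
        4 * (H 1 + 1 / π * (Real.log (t / 4) + 4 * Real.log x)) := by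
        field_simp; ring
      rw [e2]; linarith
  · have hK : 0 ≤ H 1 + 1 / π * Real.log (t / 4 + 1) := by
      have h1 : 0 ≤ H 1 := intervalIntegral.integral_nonneg (by norm_num) (fun u _ => F_nonneg u)
      have := Real.log_nonneg (by linarith : 1 ≤ t / 4 + 1)
      positivity
    refine ⟨4 * ((H 1 + 1 / π * Real.log (t / 4 + 1)) / Real.log 2 + 4 / π), fun x hx => ?_⟩
    have hx0 : 0 < x := by linarith
    have h2 : 0 < Real.log 2 := Real.log_pos (by norm_num)
    have hl : Real.log 2 ≤ Real.log x := Real.log_le_log (by norm_num) hx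
    have hx4 : 1 ≤ x ^ 4 := one_le_pow₀ (by linarith)
    have hu := H_upper ((t / 4 + 1) * x ^ 4) (by nlinarith)
    rw [hlogm _ _ (by positivity) hx0] at hu
    have hm : H (t / 4 * x ^ 4) ≤ H ((t / 4 + 1) * x ^ 4) := H_mono (by nlinarith)
    have hk : H 1 + 1 / π * Real.log (t / 4 + 1) ≤
        (H 1 + 1 / π * Real.log (t / 4 + 1)) / Real.log 2 * Real.log x := by
      rw [div_mul_eq_mul_div _ (Real.log 2), le_div_iff₀ h2]
      exact mul_le_mul_of_nonneg_left hl hK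
    have hf : H (t / 4 * x ^ 4) ≤
        ((H 1 + 1 / π * Real.log (t / 4 + 1)) / Real.log 2 + 4 / π) * Real.log x := by
      have : 1 / π * (Real.log (t / 4 + 1) + 4 * Real.log x) =
        1 / π * Real.log (t / 4 + 1) + 4 / π * Real.log x := by ring
      rw [add_mul]; linarith
    have hr : x ^ (-(4:ℝ)) = (x ^ 4)⁻¹ := by
      rw [Real.rpow_neg hx0.le]; norm_cast
    rw [hG' x hx0, hr]
    have := mul_le_mul_of_nonneg_left hf (by positivity : 0 ≤ 4 * (x ^ 4)⁻¹)
    linarith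
end

section
/- Let 0 < β < 1/2. For every t > 0 and every z ∈ ℝ, ∫_ℝ ξ² (1 − cos(ξ z)) · [ ∫_0^t E_β( -(ξ²/2)·(t−r)^β )² dr ] dξ ≤ ( 4π·Γ(1+β)² / (1−2β) ) · t^{1−2β} · |z|. -/
open MeasureTheory Real

noncomputable def cc (s : ℝ) : ℕ → ℝ
  | 0 => 1
  | n + 1 => cc s n * (s + n) / (n + 1)

lemma cc_zero (s : ℝ) : cc s 0 = 1 := rfl
lemma cc_succ (s : ℝ) (n : ℕ) : cc s (n+1) = cc s n * (s + n) / (n + 1) := rfl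

noncomputable def SS (s : ℝ) : PowerSeries ℝ := PowerSeries.mk (cc s)

lemma coeff_SS (s : ℝ) (n : ℕ) : PowerSeries.coeff n (SS s) = cc s n := by simp [SS]

open PowerSeries in
lemma SS_ode (s : ℝ) : (1 - X) * derivative ℝ (SS s) = C s * SS s := by
  ext n
  rw [sub_mul, one_mul, map_sub, coeff_C_mul]
  cases n with
  | zero => simp [coeff_derivative, coeff_SS, cc_succ, cc_zero]
  | succ n =>
    rw [coeff_succ_X_mul, coeff_derivative, coeff_derivative, coeff_SS, coeff_SS, cc_succ s (n+1)]
    push_cast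
    field_simp
    ring

open PowerSeries in
lemma ode_unique (s : ℝ) (F : PowerSeries ℝ) (h0 : coeff 0 F = 1)
    (h : (1 - X) * derivative ℝ F = C s * F) : F = SS s := by
  ext n
  rw [coeff_SS]
  induction n with
  | zero => rw [h0, cc_zero]
  | succ n ih =>
    have := congrArg (coeff n) h
    rw [sub_mul, one_mul, map_sub, coeff_C_mul] at this
    have key : coeff (n+1) F * (n+1) = (s + n) * coeff n F := by
      cases n with
      | zero => simpa [coeff_derivative] using this
      | succ m =>
        rw [coeff_succ_X_mul, coeff_derivative, coeff_derivative] at this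
        push_cast at this ⊢
        linarith
    rw [cc_succ, ← ih, eq_div_iff (by positivity), key]; ring

open PowerSeries in
lemma SS_mul (s r : ℝ) : SS s * SS r = SS (s + r) := by
  apply ode_unique
  · simp [SS, cc_zero]
  · rw [Derivation.leibniz, smul_eq_mul, smul_eq_mul, mul_add, map_add]
    linear_combination (SS s) * SS_ode r + SS r * SS_ode s

lemma SS_zero : SS 0 = 1 := by
  symm; apply ode_unique <;> simp

open PowerSeries in
lemma SS_neg_one : SS (-1) = 1 - X := by
  symm; apply ode_unique
  · simp
  · simp [derivative_X]

lemma cc_pos (s : ℝ) (hs : 0 < s) (n : ℕ) : 0 < cc s n := by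
  induction n with
  | zero => simp [cc_zero]
  | succ n ih => rw [cc_succ]; positivity

lemma cc_one (n : ℕ) : cc 1 n = 1 := by
  induction n with
  | zero => simp [cc_zero]
  | succ n ih => rw [cc_succ, ih]; field_simp; ring

lemma cc_neg (β : ℝ) (h0 : 0 < β) (h1 : β < 1) (n : ℕ) : cc (-β) (n+1) ≤ 0 := by
  induction n with
  | zero => simp [cc_succ, cc_zero, h0.le]
  | succ n ih =>
    rw [cc_succ]
    apply div_nonpos_of_nonpos_of_nonneg _ (by positivity)
    apply mul_nonpos_of_nonpos_of_nonneg ih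
    push_cast
    have : (0:ℝ) ≤ n := by positivity
    linarith

lemma cc_le (s : ℝ) (hs : 1 ≤ s) (n : ℕ) : cc s n ≤ s ^ n := by
  induction n with
  | zero => simp [cc_zero]
  | succ n ih =>
    rw [cc_succ, div_le_iff₀ (by positivity), pow_succ, mul_assoc]
    have : (0:ℝ) ≤ n := by positivity
    apply mul_le_mul ih _ (by positivity) (by positivity)
    nlinarith

open PowerSeries in
lemma pos_of_eq (h : ℝ) (hh : 0 < h) (β : ℝ) (h0 : 0 < β) (h1 : β < 1) (F P : PowerSeries ℝ)
    (hP : ∀ n, 0 ≤ coeff n P) (hF : F * (SS (-β) + C h) = P) (n : ℕ) : 0 ≤ coeff n F := by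
  induction n using Nat.strong_induction_on with
  | _ n ih =>
    have := congrArg (coeff n) hF
    rw [mul_add, map_add, coeff_mul_C, mul_comm F, coeff_mul,
      Finset.Nat.sum_antidiagonal_eq_sum_range_succ (fun i j => coeff i (SS (-β)) * coeff j F),
      Finset.sum_range_succ'] at this
    simp only [coeff_SS, cc_zero, Nat.sub_zero, one_mul] at this
    have h2 : ∑ i ∈ Finset.range n, cc (-β) (i+1) * coeff (n - (i+1)) F ≤ 0 := by
      apply Finset.sum_nonpos
      intro i hi
      rw [Finset.mem_range] at hi
      exact mul_nonpos_of_nonpos_of_nonneg (cc_neg β h0 h1 i) (ih _ (by omega))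
    have h3 := hP n
    have h4 : 0 ≤ coeff n F * (1 + h) := by linarith
    exact nonneg_of_mul_nonneg_left h4 (by linarith)

open PowerSeries in
lemma disc (h : ℝ) (hh : 0 < h) (β : ℝ) (h0 : 0 < β) (h1 : β < 1) (A : PowerSeries ℝ)
    (hA : A * (1 + C h * SS β) = SS 1) (n : ℕ) :
    0 ≤ coeff n A ∧ coeff n A * (h * cc (1 + β) n) ≤ 1 := by
  have e1 : SS (-β) * SS β = 1 := by rw [SS_mul]; simp [SS_zero]
  have e2 : SS (-1) * SS 1 = 1 := by rw [SS_mul]; simp [SS_zero]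
  have hA2 : A * (SS (-β) + C h) = SS (1 - β) := by
    rw [sub_eq_add_neg, ← SS_mul, ← hA]
    linear_combination (-A * C h) * e1
  have hpos : ∀ n, 0 ≤ coeff n A := pos_of_eq h hh β h0 h1 A _
    (fun n => by rw [coeff_SS]; exact (cc_pos _ (by linarith) n).le) hA2
  have hc : constantCoeff (SS (-β) + C h) ≠ 0 := by
    rw [← coeff_zero_eq_constantCoeff_apply, map_add, coeff_SS, cc_zero]; simp; linarith
  have hR : (SS (-β) + C h)⁻¹ * (SS (-β) + C h) = 1 := PowerSeries.inv_mul_cancel _ hc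
  set R := (SS (-β) + C h)⁻¹
  have hRpos : ∀ n, 0 ≤ coeff n R := pos_of_eq h hh β h0 h1 R _
    (fun n => by rw [coeff_one]; split_ifs <;> simp) hR
  have hD : (1 - X) * A = 1 - C h * R := by
    rw [← SS_neg_one]
    have : SS (-1) * A = SS (-β) * R := by
      have := hA2
      rw [sub_eq_add_neg, ← SS_mul] at this
      linear_combination SS (-1) * R * this - SS (-1) * A * hR + SS (-β) * R * e2
    rw [this]
    linear_combination hR
  have hanti : Antitone (fun n => coeff n A) := by
    apply antitone_nat_of_succ_le
    intro n
    have := congrArg (coeff (n+1)) hD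
    rw [sub_mul, one_mul, map_sub, coeff_succ_X_mul, map_sub, coeff_C_mul, coeff_one] at this
    have h5 := mul_nonneg hh.le (hRpos (n+1))
    simp at this
    linarith
  refine ⟨hpos n, ?_⟩
  have h6 := congrArg (coeff n) hA
  have h7 : A * (1 + C h * SS β) = A + C h * (SS β * A) := by ring
  rw [h7, map_add, coeff_C_mul, coeff_mul, coeff_SS, cc_one] at h6
  have h8 : coeff n (SS β * SS 1) = cc (1+β) n := by rw [SS_mul, coeff_SS, add_comm]
  rw [coeff_mul] at h8
  simp only [coeff_SS, cc_one, mul_one] at h8 h6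
  have h9 : coeff n A * cc (1+β) n ≤ ∑ p ∈ Finset.HasAntidiagonal.antidiagonal n, cc β p.1 * coeff p.2 A := by
    rw [← h8, Finset.mul_sum]
    apply Finset.sum_le_sum
    intro p hp
    rw [Finset.HasAntidiagonal.mem_antidiagonal] at hp
    rw [mul_comm]
    exact mul_le_mul_of_nonneg_left (hanti (by omega)) (cc_pos β h0 _).le
  have := mul_le_mul_of_nonneg_left h9 hh.le
  have := hpos n
  linarith

lemma summ (h : ℝ) (hh : 0 < h) (hh1 : h < 1) (β : ℝ) (h0 : 0 < β) (h1 : β < 1) (m : ℕ) :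
    Summable (fun k : ℕ => h ^ k * cc (1 + β * k) m) := by
  have s1 : Summable (fun k : ℕ => ((k:ℝ)) ^ m * h ^ k : ℕ → ℝ) :=
    summable_pow_mul_geometric_of_norm_lt_one m (by rw [Real.norm_eq_abs, abs_of_pos hh]; exact hh1)
  have s2 := ((summable_nat_add_iff 1).2 s1).mul_left (h⁻¹)
  refine Summable.of_nonneg_of_le (fun k => ?_) (fun k => ?_) s2
  · have := cc_pos (1 + β * k) (by positivity) m
    positivity
  · have h3 : (0:ℝ) ≤ k := by positivity
    have h2 : cc (1 + β * k) m ≤ (k+1:ℝ)^m := by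
      refine (cc_le _ (by nlinarith [mul_nonneg h0.le h3]) m).trans ?_
      apply pow_le_pow_left₀ (by positivity)
      nlinarith
    have : h⁻¹ * (((k+1:ℕ):ℝ)^m * h^(k+1)) = h^k * (k+1:ℝ)^m := by
      push_cast; rw [pow_succ]; field_simp
    rw [this]
    gcongr

lemma summ' (h : ℝ) (hh : 0 < h) (hh1 : h < 1) (β : ℝ) (h0 : 0 < β) (h1 : β < 1) (m : ℕ) :
    Summable (fun k : ℕ => (-h) ^ k * cc (1 + β * k) m) := by
  refine Summable.of_norm ((summ h hh hh1 β h0 h1 m).congr fun k => ?_)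
  rw [norm_mul, norm_pow, norm_neg, Real.norm_eq_abs, Real.norm_eq_abs, abs_of_pos hh,
    abs_of_pos (cc_pos _ (by positivity) m)]

lemma conv_cc (β y : ℝ) (m : ℕ) : ∑ i ∈ Finset.HasAntidiagonal.antidiagonal m, cc β i.1 * cc y i.2
      = cc (β + y) m := by
  rw [← coeff_SS, ← SS_mul, PowerSeries.coeff_mul]
  simp only [coeff_SS]

lemma tele (h : ℝ) (hh : 0 < h) (hh1 : h < 1) (β : ℝ) (h0 : 0 < β) (h1 : β < 1) (m : ℕ) :
    (∑' k : ℕ, (-h) ^ k * cc (1 + β * k) m) + h * ∑ i ∈ Finset.HasAntidiagonal.antidiagonal m,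
      cc β i.1 * ∑' k : ℕ, (-h) ^ k * cc (1 + β * k) i.2 = 1 := by
  simp_rw [← tsum_mul_left]
  have hs : ∀ i ∈ Finset.HasAntidiagonal.antidiagonal m,
      Summable (fun k : ℕ => cc β i.1 * ((-h) ^ k * cc (1 + β * k) i.2)) := fun i _ =>
    Summable.mul_left (cc β i.1) (summ' h hh hh1 β h0 h1 i.2)
  rw [← Summable.tsum_finsetSum hs]
  have e : ∀ k : ℕ, ∑ i ∈ Finset.HasAntidiagonal.antidiagonal m, cc β i.1 * ((-h)^k * cc (1 + β * k) i.2)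
      = (-h)^k * cc (1 + β * ((k+1 : ℕ) : ℝ)) m := by
    intro k
    have e1 : 1 + β * ((k+1 : ℕ) : ℝ) = β + (1 + β * k) := by push_cast; ring
    rw [e1, ← conv_cc, Finset.mul_sum]
    apply Finset.sum_congr rfl
    intro i _
    ring
  rw [tsum_congr e, (summ' h hh hh1 β h0 h1 m).tsum_eq_zero_add, ← tsum_mul_left]
  have e3 : ∀ k : ℕ, h * ((-h)^k * cc (1 + β * ((k+1 : ℕ) : ℝ)) m) =
      -((-h)^(k+1) * cc (1 + β * ((k+1 : ℕ) : ℝ)) m) := by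
    intro k; rw [pow_succ]; ring
  rw [tsum_congr e3, tsum_neg]
  simp [cc_one]

lemma disc2 (h : ℝ) (hh : 0 < h) (hh1 : h < 1) (β : ℝ) (h0 : 0 < β) (h1 : β < 1) (n : ℕ) :
    0 ≤ ∑' k : ℕ, (-h) ^ k * cc (1 + β * k) n ∧
    (∑' k : ℕ, (-h) ^ k * cc (1 + β * k) n) * (h * cc (1 + β) n) ≤ 1 := by
  have hA : (PowerSeries.mk fun n => ∑' k : ℕ, (-h) ^ k * cc (1 + β * k) n) *
      (1 + PowerSeries.C h * SS β) = SS 1 := by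
    ext m
    have h7 : ∀ A : PowerSeries ℝ, A * (1 + PowerSeries.C h * SS β) =
      A + PowerSeries.C h * (SS β * A) := fun A => by ring
    rw [h7, map_add, PowerSeries.coeff_C_mul, PowerSeries.coeff_mul]
    simp only [PowerSeries.coeff_mk, coeff_SS, cc_one]
    exact tele h hh hh1 β h0 h1 m
  have := disc h hh β h0 h1 _ hA n
  rwa [PowerSeries.coeff_mk] at this

noncomputable def Ph (y : ℝ) (n : ℕ) : ℝ := cc (1 + y) n / (n:ℝ) ^ y

lemma Ph_anti (y : ℝ) (hy : 0 ≤ y) (N : ℕ) (hN : 1 ≤ N) (n : ℕ) (hn : N ≤ n) : Ph y n ≤ Ph y N := by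
  induction n, hn using Nat.le_induction with
  | base => exact le_rfl
  | succ n hn ih =>
    refine le_trans ?_ ih
    have hn0 : (0:ℝ) < n := by exact_mod_cast (by omega : 0 < n)
    have hc := cc_pos (1+y) (by linarith) n
    unfold Ph
    rw [cc_succ]
    push_cast
    have key : (1 + y + n) / (n+1) ≤ ((n+1:ℝ)/n) ^ y := by
      have h1 : (1 + y + n) / (n+1) = y / (n+1) + 1 := by field_simp; ring
      rw [h1]
      refine (add_one_le_exp _).trans ?_
      rw [rpow_def_of_pos (by positivity), exp_le_exp]
      have := one_sub_inv_le_log_of_pos (x := (n+1:ℝ)/n) (by positivity)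
      have h2 : 1 - ((n+1:ℝ)/n)⁻¹ = 1 / (n+1) := by field_simp; ring
      rw [h2] at this
      calc y / (n+1) = 1 / (n+1) * y := by ring
        _ ≤ _ := by gcongr
    rw [div_rpow (by positivity) (by positivity)] at key
    have p1 : (0:ℝ) < (n:ℝ)^y := by positivity
    have p2 : (0:ℝ) < ((n:ℝ)+1)^y := by positivity
    rw [div_le_div_iff₀ p2 p1]
    rw [le_div_iff₀ p1] at key
    calc cc (1+y) n * (1 + y + n) / (n+1) * (n:ℝ)^y = cc (1+y) n * ((1 + y + n) / (n+1) * (n:ℝ)^y) := by ring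
      _ ≤ _ := by gcongr

lemma prod_cc (s : ℝ) (n : ℕ) : ∏ j ∈ Finset.range n, (s + j) = cc s n * n.factorial := by
  induction n with
  | zero => simp [cc_zero]
  | succ n ih => rw [Finset.prod_range_succ, ih, cc_succ, Nat.factorial_succ]; push_cast; field_simp

lemma Ph_lim (y : ℝ) (hy : 0 ≤ y) :
    Filter.Tendsto (Ph y) Filter.atTop (nhds (1 / Gamma (1 + y))) := by
  have hG : 0 < Gamma (1+y) := Gamma_pos_of_pos (by linarith)
  have h1 := (GammaSeq_tendsto_Gamma (1+y)).inv₀ hG.ne'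
  have h2 : Filter.Tendsto (fun n : ℕ => (n:ℝ) / (n + (1+y))) Filter.atTop (nhds 1) :=
    tendsto_natCast_div_add_atTop (1+y)
  have h3 := h1.mul h2
  rw [mul_one, ← one_div] at h3
  refine h3.congr' ?_
  filter_upwards [Filter.eventually_ge_atTop 1] with n hn
  have hn0 : (0:ℝ) < n := by exact_mod_cast (by omega : 0 < n)
  have hc := cc_pos (1+y) (by linarith) n
  have p1 : (0:ℝ) < (n:ℝ)^y := by positivity
  have hf : (0:ℝ) < n.factorial := by positivity
  unfold GammaSeq Ph
  rw [Finset.prod_range_succ, prod_cc, rpow_add hn0, rpow_one]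
  have : 1 + y + (n:ℝ) ≠ 0 := by positivity
  have : (n:ℝ) + (1 + y) ≠ 0 := by positivity
  field_simp
  ring

lemma ml_bound_s16 (β : ℝ) (h0 : 0 < β) (h1 : β < 1) (x : ℝ) (hx : 0 < x) :
    0 ≤ mittagLeffler β (-x) ∧ mittagLeffler β (-x) ≤ Gamma (1 + β) / x := by
  have hpow : Filter.Tendsto (fun n : ℕ => (n:ℝ)^β) Filter.atTop Filter.atTop :=
    (tendsto_rpow_atTop h0).comp tendsto_natCast_atTop_atTop
  obtain ⟨N, hN⟩ := Filter.eventually_atTop.1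
    ((hpow.eventually_gt_atTop x).and (Filter.eventually_ge_atTop 1))
  have term : ∀ n, N ≤ n → ∀ k : ℕ, (x / (n:ℝ)^β)^k * cc (1 + β * k) n = x^k * Ph (β * k) n := by
    intro n hn k
    unfold Ph
    rw [rpow_mul (by positivity), rpow_natCast, div_pow]
    ring
  have term' : ∀ n, N ≤ n → ∀ k : ℕ, (-(x / (n:ℝ)^β))^k * cc (1 + β * k) n = (-x)^k * Ph (β * k) n := by
    intro n hn k
    rw [neg_pow, neg_pow x, mul_assoc, term n hn k, mul_assoc]
  have hpos : ∀ n, N ≤ n → 0 < x / (n:ℝ)^β ∧ x / (n:ℝ)^β < 1 := by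
    intro n hn
    have h2 := (hN n hn).1
    have : 0 < (n:ℝ)^β := hx.trans h2
    exact ⟨by positivity, (div_lt_one this).2 h2⟩
  have hlim : Filter.Tendsto (fun n : ℕ => ∑' k : ℕ, (-x)^k * Ph (β * k) n) Filter.atTop
      (nhds (mittagLeffler β (-x))) := by
    unfold mittagLeffler
    refine tendsto_tsum_of_dominated_convergence (bound := fun k : ℕ => x^k * Ph (β * k) N) ?_ ?_ ?_
    · exact (summ _ (hpos N le_rfl).1 (hpos N le_rfl).2 β h0 h1 N).congr (term N le_rfl)
    · intro k
      have := (Ph_lim (β * k) (by positivity)).const_mul ((-x)^k)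
      rwa [mul_one_div] at this
    · filter_upwards [Filter.eventually_ge_atTop N] with n hn k
      have hk : 0 ≤ β * k := by positivity
      have : 0 ≤ Ph (β * k) n := div_nonneg (cc_pos _ (by linarith) _).le (by positivity)
      rw [norm_mul, norm_pow, norm_neg, Real.norm_eq_abs, Real.norm_eq_abs, abs_of_pos hx, abs_of_nonneg this]
      gcongr
      exact Ph_anti _ hk N (hN N le_rfl).2 n hn
  have hd : ∀ n, N ≤ n → 0 ≤ ∑' k : ℕ, (-x)^k * Ph (β * k) n ∧
      (∑' k : ℕ, (-x)^k * Ph (β * k) n) * (x * Ph β n) ≤ 1 := by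
    intro n hn
    have := disc2 _ (hpos n hn).1 (hpos n hn).2 β h0 h1 n
    rw [tsum_congr (term' n hn)] at this
    refine ⟨this.1, le_of_eq_of_le ?_ this.2⟩
    unfold Ph; ring
  constructor
  · exact ge_of_tendsto hlim (Filter.eventually_atTop.2 ⟨N, fun n hn => (hd n hn).1⟩)
  · have h3 := hlim.mul ((Ph_lim β h0.le).const_mul x)
    have h4 := le_of_tendsto h3 (Filter.eventually_atTop.2 ⟨N, fun n hn => (hd n hn).2⟩)
    have hG : 0 < Gamma (1+β) := Gamma_pos_of_pos (by linarith)
    rw [le_div_iff₀ hx]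
    rw [← mul_assoc, mul_one_div, div_le_one hG] at h4
    exact h4

lemma lint_ftc {g g' : ℝ → ℝ} (hd : ∀ x, HasDerivAt g (g' x) x)
    (hn : ∀ x ∈ Set.Ioi (0:ℝ), 0 ≤ g' x) (hl : Filter.Tendsto g Filter.atTop (nhds 0)) :
    ∫⁻ x in Set.Ioi (0:ℝ), ENNReal.ofReal (g' x) = ENNReal.ofReal (- g 0) := by
  have hc : ContinuousWithinAt g (Set.Ici 0) 0 := (hd 0).continuousAt.continuousWithinAt
  rw [← ofReal_integral_eq_lintegral_ofReal
    (integrableOn_Ioi_deriv_of_nonneg hc (fun x _ => hd x) hn hl),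
    integral_Ioi_of_hasDerivAt_of_nonneg hc (fun x _ => hd x) hn hl, zero_sub]
  exact (ae_restrict_iff' measurableSet_Ioi).2 (Filter.Eventually.of_forall hn)

lemma lint_s (x : ℝ) (hx : 0 < x) :
    ∫⁻ s in Set.Ioi (0:ℝ), ENNReal.ofReal ((1 - cos x) * (s * exp (-(s * x))))
      = ENNReal.ofReal ((1 - cos x) / x ^ 2) := by
  have hc : 0 ≤ 1 - cos x := by linarith [cos_le_one x]
  rw [lint_ftc (g := fun s => -(1 - cos x) * ((s / x + 1 / x^2) * exp (-(s * x))))]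
  · congr 1; simp; ring
  · intro s
    have h1 : HasDerivAt (fun s : ℝ => exp (-(s * x))) (exp (-(s*x)) * (-(1 * x))) s :=
      (((hasDerivAt_id s).mul_const x).neg).exp
    have h2 : HasDerivAt (fun s : ℝ => s / x + 1 / x^2) (1 / x) s :=
      ((hasDerivAt_id s).div_const x).add_const _
    refine ((h2.mul h1).const_mul (-(1 - cos x))).congr_deriv ?_
    field_simp
    ring
  · intro s hs
    have : (0:ℝ) < s := hs
    positivity
  · have h1 : Filter.Tendsto (fun s : ℝ => s * x) Filter.atTop Filter.atTop :=
      Filter.tendsto_id.atTop_mul_const hx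
    have h2 : Filter.Tendsto (fun s : ℝ => s ^ 1 * exp (-s)) Filter.atTop (nhds 0) :=
      tendsto_pow_mul_exp_neg_atTop_nhds_zero 1
    have h3 : Filter.Tendsto (fun s : ℝ => s ^ 0 * exp (-s)) Filter.atTop (nhds 0) :=
      tendsto_pow_mul_exp_neg_atTop_nhds_zero 0
    have := (((h2.comp h1).add (h3.comp h1)).const_mul (1/x^2)).const_mul (-(1 - cos x))
    simp only [add_zero, mul_zero] at this
    refine this.congr fun s => ?_
    simp only [Function.comp]
    field_simp

lemma lint_x (s : ℝ) (hs : 0 < s) :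
    ∫⁻ x in Set.Ioi (0:ℝ), ENNReal.ofReal ((1 - cos x) * (s * exp (-(s * x))))
      = ENNReal.ofReal ((1 + s ^ 2)⁻¹) := by
  rw [lint_ftc (g := fun x => (-1 + s * (s * cos x - sin x) / (1 + s^2)) * exp (-(s * x)))]
  · congr 1; simp; field_simp; ring
  · intro x
    have h1 : HasDerivAt (fun x : ℝ => exp (-(s * x))) (exp (-(s*x)) * (-(s * 1))) x :=
      (((hasDerivAt_id x).const_mul s).neg).exp
    have h2 : HasDerivAt (fun x : ℝ => -1 + s * (s * cos x - sin x) / (1 + s^2))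
        (s * (s * (-sin x) - cos x) / (1 + s^2)) x :=
      (((((hasDerivAt_cos x).const_mul s).sub (hasDerivAt_sin x)).const_mul s).div_const _).const_add _
    refine (h2.mul h1).congr_deriv ?_
    field_simp
    ring
  · intro x _
    have hc : 0 ≤ 1 - cos x := by linarith [cos_le_one x]
    positivity
  · have h1 : Filter.Tendsto (fun x : ℝ => s * x) Filter.atTop Filter.atTop :=
      Filter.tendsto_id.const_mul_atTop hs
    have h3 : Filter.Tendsto (fun s : ℝ => s ^ 0 * exp (-s)) Filter.atTop (nhds 0) :=
      tendsto_pow_mul_exp_neg_atTop_nhds_zero 0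
    have := (h3.comp h1).const_mul (1 + s * (s + 1))
    rw [mul_zero] at this
    refine squeeze_zero_norm (fun x => ?_) this
    simp only [Function.comp, pow_zero, one_mul]
    rw [norm_mul, Real.norm_eq_abs, Real.norm_eq_abs, abs_of_pos (exp_pos _)]
    gcongr
    refine (abs_add_le _ _).trans ?_
    rw [abs_neg, abs_one, abs_div, abs_mul, abs_of_pos hs, abs_of_pos (by positivity : 0 < 1 + s^2)]
    gcongr
    rw [div_le_iff₀ (by positivity)]
    have : |s * cos x - sin x| ≤ s + 1 := by
      refine (abs_sub _ _).trans ?_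
      rw [abs_mul, abs_of_pos hs]
      have := abs_cos_le_one x
      have := abs_sin_le_one x
      nlinarith
    calc s * |s * cos x - sin x| ≤ s * (s+1) := by gcongr
      _ ≤ s * (s+1) * (1 + s^2) := by
        apply le_mul_of_one_le_right (by positivity); nlinarith [sq_nonneg s]

lemma phi_integrable : Integrable (fun u : ℝ => (1 - cos u) / u ^ 2) := by
  refine (integrable_inv_one_add_sq.const_mul 3).mono' (Measurable.aestronglyMeasurable (by measurability)) (Filter.Eventually.of_forall fun u => ?_)
  have hc : 0 ≤ 1 - cos u := by linarith [cos_le_one u]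
  rw [Real.norm_eq_abs, abs_of_nonneg (by positivity)]
  by_cases hu : u = 0
  · subst hu; simp
  have h1 := one_sub_sq_div_two_le_cos (x := u)
  have h2 := neg_one_le_cos u
  have : 0 < u^2 := by positivity
  rw [← div_eq_mul_inv, div_le_div_iff₀ (by positivity) (by positivity)]
  nlinarith

lemma phi_integral : ∫ u : ℝ, (1 - cos u) / u ^ 2 = π := by
  have h1 := integral_comp_abs (f := fun u : ℝ => (1 - cos u) / u ^ 2)
  simp only [cos_abs, sq_abs] at h1
  rw [h1]
  have h2 : ∫⁻ u in Set.Ioi (0:ℝ), ENNReal.ofReal ((1 - cos u) / u ^ 2) = ENNReal.ofReal (π/2) := by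
    rw [← setLIntegral_congr_fun measurableSet_Ioi (fun x hx => lint_s x hx),
      lintegral_lintegral_swap (by fun_prop),
      setLIntegral_congr_fun measurableSet_Ioi (fun x hx => lint_x x hx),
      ← ofReal_integral_eq_lintegral_ofReal integrable_inv_one_add_sq.integrableOn
        (Filter.Eventually.of_forall fun x => by positivity), integral_Ioi_inv_one_add_sq]
    simp
  rw [integral_eq_lintegral_of_nonneg_ae, h2, ENNReal.toReal_ofReal (by positivity)]
  · ring
  · refine Filter.Eventually.of_forall fun u => ?_
    have hc : 0 ≤ 1 - cos u := by linarith [cos_le_one u]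
    show (0:ℝ) ≤ _
    positivity
  · exact phi_integrable.aestronglyMeasurable.restrict

lemma phi_z (z : ℝ) (hz : z ≠ 0) : Integrable (fun x : ℝ => (1 - cos (x * z)) / x ^ 2) ∧
    ∫ x : ℝ, (1 - cos (x * z)) / x ^ 2 = π * |z| := by
  have e : (fun x : ℝ => (1 - cos (x * z)) / x ^ 2) =
      fun x => z^2 * ((fun u : ℝ => (1 - cos u) / u ^ 2) (x * z)) := by
    ext x
    by_cases hx : x = 0
    · simp [hx]
    · field_simp
  rw [e]
  refine ⟨(phi_integrable.comp_mul_right' hz).const_mul _, ?_⟩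
  rw [integral_const_mul, Measure.integral_comp_mul_right (fun u : ℝ => (1 - cos u) / u ^ 2) z, phi_integral, abs_inv, ← sq_abs, smul_eq_mul]
  have : |z| ≠ 0 := by positivity
  field_simp

lemma inner_bound (β : ℝ) (hβ0 : 0 < β) (hβ : β < 1 / 2) (t : ℝ) (ht : 0 < t) (x : ℝ) (hx : x ≠ 0) :
    ∫ r in (0 : ℝ)..t, (mittagLeffler β (-(x ^ 2 / 2) * (t - r) ^ β)) ^ 2 ≤
      4 * Gamma (1 + β) ^ 2 / x ^ 4 * (t ^ (1 - 2 * β) / (1 - 2 * β)) := by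
  have hI : IntervalIntegrable (fun u : ℝ => u ^ (-(2 * β))) volume 0 t :=
    intervalIntegral.intervalIntegrable_rpow' (by linarith)
  have hI2 : IntervalIntegrable (fun r : ℝ => (t - r) ^ (-(2 * β))) volume 0 t := by
    have := hI.comp_sub_left t
    simpa using this.symm
  have hv : ∫ r in (0:ℝ)..t, (t - r) ^ (-(2 * β)) = t ^ (1 - 2 * β) / (1 - 2 * β) := by
    rw [intervalIntegral.integral_comp_sub_left (fun u : ℝ => u ^ (-(2 * β)))]
    simp only [sub_self, sub_zero]
    rw [integral_rpow (Or.inl (by linarith)), zero_rpow (by linarith)]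
    have : -(2 * β) + 1 = 1 - 2 * β := by ring
    rw [this, sub_zero]
  rw [← hv, ← intervalIntegral.integral_const_mul, intervalIntegral.integral_of_le ht.le,
    intervalIntegral.integral_of_le ht.le, integral_Ioc_eq_integral_Ioo, integral_Ioc_eq_integral_Ioo]
  apply integral_mono_of_nonneg
  · exact Filter.Eventually.of_forall fun r => sq_nonneg _
  · exact ((intervalIntegrable_iff_integrableOn_Ioo_of_le ht.le).1 hI2).const_mul _
  · refine (ae_restrict_iff' measurableSet_Ioo).2 (Filter.Eventually.of_forall fun r hr => ?_)
    have hu : 0 < t - r := by linarith [hr.2]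
    have hp : 0 < (t - r)^β := by positivity
    obtain ⟨b1, b2⟩ := ml_bound_s16 β hβ0 (by linarith) (x^2/2 * (t-r)^β) (by positivity)
    rw [← neg_mul] at b1 b2
    refine (pow_le_pow_left₀ b1 b2 2).trans (le_of_eq ?_)
    have : (t - r) ^ (-(2 * β)) = (((t-r)^β)^2)⁻¹ := by
      rw [rpow_neg hu.le, mul_comm, rpow_mul hu.le]; norm_num
    simp only [this]
    field_simp
    norm_num

/-- Gradient spatial increment bound for the `β`-time-fractional SPIDE (`0 < β < 1/2`, `d = 1`):
`∫ ξ² (1 − cos(ξz)) [∫₀^t E_β(−(ξ²/2)(t−r)^β)² dr] dξ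
  ≤ (4π Γ(1+β)²/(1−2β)) t^{1−2β} |z|`. -/
theorem spide_gradient_spatial_increment_bound
    (β : ℝ) (hβ0 : 0 < β) (hβ : β < 1 / 2) (t z : ℝ) (ht : 0 < t) :
    (∫ ξ : ℝ, ξ ^ 2 * (1 - Real.cos (ξ * z)) *
      ∫ r in (0 : ℝ)..t, (mittagLeffler β (-(ξ ^ 2 / 2) * (t - r) ^ β)) ^ 2)
      ≤ (4 * π * Real.Gamma (1 + β) ^ 2 / (1 - 2 * β)) * t ^ (1 - 2 * β) * |z| := by
  by_cases hz : z = 0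
  · subst hz; simp
  obtain ⟨i1, i2⟩ := phi_z z hz
  set K := 4 * Gamma (1 + β) ^ 2 * (t ^ (1 - 2 * β) / (1 - 2 * β)) with hK
  have hb : 0 < 1 - 2 * β := by linarith
  have : (4 * π * Real.Gamma (1 + β) ^ 2 / (1 - 2 * β)) * t ^ (1 - 2 * β) * |z| =
      ∫ x : ℝ, K * ((1 - cos (x * z)) / x ^ 2) := by
    rw [integral_const_mul, i2, hK]; ring
  rw [this]
  apply integral_mono_of_nonneg
  · refine Filter.Eventually.of_forall fun x => ?_
    have hc : 0 ≤ 1 - cos (x * z) := by linarith [cos_le_one (x * z)]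
    have : 0 ≤ ∫ r in (0 : ℝ)..t, (mittagLeffler β (-(x ^ 2 / 2) * (t - r) ^ β)) ^ 2 :=
      intervalIntegral.integral_nonneg ht.le (fun r _ => sq_nonneg _)
    show (0:ℝ) ≤ _
    positivity
  · exact i1.const_mul _
  · refine Filter.Eventually.of_forall fun x => ?_
    have hc : 0 ≤ 1 - cos (x * z) := by linarith [cos_le_one (x * z)]
    by_cases hx : x = 0
    · subst hx; simp
    refine (mul_le_mul_of_nonneg_left (inner_bound β hβ0 hβ t ht x hx) (by positivity)).trans
      (le_of_eq ?_)
    simp only [hK]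
    field_simp
end

section
/- Fix t > 0 and for ξ ∈ ℝ let G_t(ξ) = ∫_0^t ( exp(r ξ⁴ / 4) · (2/√π) ∫_{√r ξ² / 2}^∞ e^{-u²} du )² dr. Then there exists a finite constant C (depending on t) such that for all z ∈ ℝ with 0 < |z| ≤ 1/2, ∫_ℝ ξ² (1 − cos(ξ z)) · G_t(ξ) dξ ≤ C · |z| · log(1/|z|). -/
open MeasureTheory Real

lemma aux_erfc (x : ℝ) (hx : 0 ≤ x) :
    Real.exp (x ^ 2) * ((2 / Real.sqrt π) * ∫ u in Set.Ioi x, Real.exp (-u ^ 2)) ≤ 3 / (1 + x) := by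
  have h1 : (∫ u in Set.Ioi x, Real.exp (-u ^ 2)) ≤
      ∫ u in Set.Ioi x, Real.exp (1 - x ^ 2 + 2 * (1 + x) * x) * Real.exp (-(2 * (1 + x)) * u) := by
    apply integral_mono_of_nonneg
    · exact Filter.Eventually.of_forall fun u => (Real.exp_pos _).le
    · exact (integrableOn_exp_mul_Ioi (by linarith) x).const_mul _
    · refine Filter.Eventually.of_forall fun u => ?_
      show Real.exp _ ≤ _ * _
      rw [← Real.exp_add]
      apply Real.exp_le_exp.mpr
      nlinarith [sq_nonneg (u - x - 1)]
  rw [integral_const_mul, integral_exp_mul_Ioi (by linarith)] at h1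
  have h2 : Real.exp (1 - x ^ 2 + 2 * (1 + x) * x) * (-Real.exp (-(2 * (1 + x)) * x) / -(2 * (1 + x)))
      = Real.exp (-x ^ 2) * Real.exp 1 / (2 * (1 + x)) := by
    rw [neg_div_neg_eq, ← mul_div_assoc, ← Real.exp_add, ← Real.exp_add]
    congr 2; ring
  rw [h2] at h1
  have h3 : 2 / Real.sqrt π ≤ 2 := by
    apply div_le_self (by norm_num)
    rw [Real.one_le_sqrt]; linarith [Real.pi_gt_three]
  have h4 : Real.exp 1 ≤ 3 := by linarith [Real.exp_one_lt_d9]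
  have h5 : 0 ≤ ∫ u in Set.Ioi x, Real.exp (-u ^ 2) :=
    integral_nonneg fun u => (Real.exp_pos _).le
  calc _ ≤ Real.exp (x ^ 2) * (2 * (Real.exp (-x ^ 2) * Real.exp 1 / (2 * (1 + x)))) := by
        gcongr
    _ = Real.exp 1 / (1 + x) := by
        rw [Real.exp_neg]; field_simp
    _ ≤ _ := by gcongr

lemma aux_G (t : ℝ) (ht : 0 < t) (ξ : ℝ) (hξ : ξ ≠ 0) :
    (∫ r in (0 : ℝ)..t,
        (Real.exp (r * ξ ^ 4 / 4) *
          ((2 / Real.sqrt π) *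
            ∫ u in Set.Ioi (Real.sqrt r * ξ ^ 2 / 2), Real.exp (-u ^ 2))) ^ 2)
    ≤ 36 * Real.log (1 + t * ξ ^ 4 / 4) / ξ ^ 4 := by
  have ha : 0 < ξ ^ 4 := by positivity
  have hcont : ContinuousOn (fun r : ℝ => 9 / (1 + r * ξ ^ 4 / 4)) (Set.uIcc 0 t) := by
    apply ContinuousOn.div (by fun_prop) (by fun_prop)
    intro r hr
    rw [Set.uIcc_of_le ht.le] at hr
    have := hr.1
    positivity
  have h1 : (∫ r in (0 : ℝ)..t, 9 / (1 + r * ξ ^ 4 / 4)) =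
      36 * Real.log (1 + t * ξ ^ 4 / 4) / ξ ^ 4 - 36 * Real.log (1 + 0 * ξ ^ 4 / 4) / ξ ^ 4 := by
    apply intervalIntegral.integral_eq_sub_of_hasDerivAt
      (f := fun r => 36 * Real.log (1 + r * ξ ^ 4 / 4) / ξ ^ 4)
    · intro r hr
      rw [Set.uIcc_of_le ht.le] at hr
      have := hr.1
      have hp : 0 < 1 + r * ξ ^ 4 / 4 := by positivity
      have := ((((((hasDerivAt_id r).mul_const (ξ ^ 4)).div_const 4).const_add 1).log hp.ne').const_mul
        36).div_const (ξ ^ 4)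
      refine this.congr_deriv ?_
      simp only [id]
      field_simp
      norm_num
    · exact hcont.intervalIntegrable
  have h2 : 36 * Real.log (1 + t * ξ ^ 4 / 4) / ξ ^ 4 = ∫ r in (0 : ℝ)..t, 9 / (1 + r * ξ ^ 4 / 4) := by
    rw [h1]; simp
  rw [h2, intervalIntegral.integral_of_le ht.le, intervalIntegral.integral_of_le ht.le]
  apply integral_mono_of_nonneg
  · exact Filter.Eventually.of_forall fun r => sq_nonneg _
  · exact (hcont.intervalIntegrable (μ := volume)).1
  · refine (ae_restrict_iff' measurableSet_Ioc).mpr (Filter.Eventually.of_forall fun r hr => ?_)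
    have hr0 := hr.1.le
    have hx : 0 ≤ Real.sqrt r * ξ ^ 2 / 2 := by positivity
    have hx2 : r * ξ ^ 4 / 4 = (Real.sqrt r * ξ ^ 2 / 2) ^ 2 := by
      rw [div_pow, mul_pow, Real.sq_sqrt hr0]; ring
    show _ ^ 2 ≤ 9 / (1 + r * ξ ^ 4 / 4)
    rw [hx2]
    generalize Real.sqrt r * ξ ^ 2 / 2 = x at hx
    have h5 : 0 ≤ ∫ u in Set.Ioi x, Real.exp (-u ^ 2) :=
      integral_nonneg fun u => (Real.exp_pos _).le
    calc _ ≤ (3 / (1 + x)) ^ 2 := by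
          gcongr
          exact aux_erfc x hx
      _ = 9 / (1 + x) ^ 2 := by rw [div_pow]; norm_num
      _ ≤ _ := by
          gcongr
          nlinarith

lemma aux_log (t : ℝ) (ht : 0 < t) (ξ z : ℝ) (hz : 0 < |z|) (hz2 : |z| ≤ 1 / 2) :
    Real.log (1 + t * ξ ^ 4 / 4) ≤ (2 * t + 20) * Real.log (1 / |z|) * (1 + (ξ * z) ^ 2) ^ (1 / 4 : ℝ) := by
  have hL : 1 / 2 ≤ Real.log (1 / |z|) := by
    have : Real.log 2 ≤ Real.log (1 / |z|) := by
      apply Real.log_le_log (by norm_num)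
      rw [le_div_iff₀ hz]; linarith
    linarith [Real.log_two_gt_d9]
  set L := Real.log (1 / |z|) with hLdef
  have hB : 0 < 1 + (ξ * z) ^ 2 := by positivity
  have hP : 1 ≤ (1 + (ξ * z) ^ 2) ^ (1 / 4 : ℝ) :=
    Real.one_le_rpow (by nlinarith [sq_nonneg (ξ * z)]) (by norm_num)
  have hlog : Real.log (1 + (ξ * z) ^ 2) ≤ 4 * (1 + (ξ * z) ^ 2) ^ (1 / 4 : ℝ) := by
    have := Real.log_le_rpow_div hB.le (ε := 1 / 4) (by norm_num)
    linarith
  set P := (1 + (ξ * z) ^ 2) ^ (1 / 4 : ℝ)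
  have hlt : Real.log (1 + t) ≤ t := by
    have := Real.log_le_sub_one_of_pos (show 0 < 1 + t by linarith)
    linarith
  have hz4 : |z| ^ 4 ≤ 1 := pow_le_one₀ hz.le (by linarith)
  have hmain : Real.log (1 + t * ξ ^ 4 / 4) ≤
      Real.log ((1 + t) * (1 + (ξ * z) ^ 2) ^ 2 * (1 / |z|) ^ 4) := by
    apply Real.log_le_log (by positivity)
    rw [one_div, inv_pow, ← div_eq_mul_inv, le_div_iff₀ (by positivity)]
    have e : |z| ^ 4 = z ^ 4 := by
      rw [show 4 = 2 * 2 from rfl, pow_mul, sq_abs, pow_mul]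
    have e2 : ξ ^ 4 * |z| ^ 4 = ((ξ * z) ^ 2) ^ 2 := by rw [e]; ring
    have : (1 + t * ξ ^ 4 / 4) * |z| ^ 4 = |z| ^ 4 + t / 4 * ((ξ * z) ^ 2) ^ 2 := by
      rw [← e2]; ring
    rw [this]
    have hy := sq_nonneg (ξ * z)
    generalize (ξ * z) ^ 2 = y at *
    have : 0 ≤ t * y := by positivity
    have : 0 ≤ t * y ^ 2 := by positivity
    nlinarith
  rw [Real.log_mul (by positivity) (by positivity), Real.log_mul (by positivity) (by positivity),
    Real.log_pow, Real.log_pow, ← hLdef] at hmain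
  push_cast at hmain
  have hLP : 1 / 2 * P ≤ L * P := by gcongr
  have hLP2 : L ≤ L * P := by nlinarith
  have hLP3 : t * (1 / 2) ≤ t * (L * P) := by gcongr; linarith
  nlinarith

lemma aux_cos (y : ℝ) : (1 - Real.cos y) * (1 + y ^ 2) ≤ 4 * y ^ 2 := by
  have h1 := Real.one_sub_sq_div_two_le_cos (x := y)
  have h2 := Real.neg_one_le_cos y
  nlinarith [sq_nonneg y]

theorem btbm_spide_gradient_spatial_increment_bound
    (t : ℝ) (ht : 0 < t)
    (G : ℝ → ℝ)
    (hG : ∀ ξ : ℝ,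
      G ξ = ∫ r in (0 : ℝ)..t,
        (Real.exp (r * ξ ^ 4 / 4) *
          ((2 / Real.sqrt π) *
            ∫ u in Set.Ioi (Real.sqrt r * ξ ^ 2 / 2), Real.exp (-u ^ 2))) ^ 2) :
    ∃ C : ℝ, ∀ z : ℝ, 0 < |z| → |z| ≤ 1 / 2 →
      (∫ ξ : ℝ, ξ ^ 2 * (1 - Real.cos (ξ * z)) * G ξ)
        ≤ C * |z| * Real.log (1 / |z|) := by
  have hint : Integrable (fun y : ℝ => (1 + y ^ 2) ^ (-(3 / 4) : ℝ)) := by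
    have := integrable_rpow_neg_one_add_norm_sq (E := ℝ) (μ := volume) (r := 3 / 2)
      (by norm_num)
    refine this.congr (Filter.Eventually.of_forall fun y => ?_)
    simp only [Real.norm_eq_abs, sq_abs]
    norm_num
  refine ⟨144 * (2 * t + 20) * ∫ y : ℝ, (1 + y ^ 2) ^ (-(3 / 4) : ℝ), fun z hz hz2 => ?_⟩
  have hz0 : z ≠ 0 := abs_pos.mp hz
  have hGn : ∀ ξ, 0 ≤ G ξ := fun ξ => by
    rw [hG]
    exact intervalIntegral.integral_nonneg ht.le fun r _ => sq_nonneg _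
  have hL : 0 ≤ Real.log (1 / |z|) := by
    apply Real.log_nonneg
    rw [le_div_iff₀ hz]; linarith
  have key : (∫ ξ : ℝ, ξ ^ 2 * (1 - Real.cos (ξ * z)) * G ξ) ≤
      ∫ ξ : ℝ, (144 * (2 * t + 20) * |z| ^ 2 * Real.log (1 / |z|)) *
        (fun y : ℝ => (1 + y ^ 2) ^ (-(3 / 4) : ℝ)) (ξ * z) := by
    apply integral_mono_of_nonneg
    · refine Filter.Eventually.of_forall fun ξ => ?_
      have h1 := Real.cos_le_one (ξ * z)
      exact mul_nonneg (mul_nonneg (sq_nonneg _) (by linarith)) (hGn ξ)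
    · exact (hint.comp_mul_right' hz0).const_mul _
    · refine Filter.Eventually.of_forall fun ξ => ?_
      show ξ ^ 2 * (1 - Real.cos (ξ * z)) * G ξ ≤ _ * (1 + (ξ * z) ^ 2) ^ (-(3 / 4) : ℝ)
      by_cases hξ : ξ = 0
      · subst hξ
        simp only [ne_eq, OfNat.ofNat_ne_zero, not_false_eq_true, zero_pow, zero_mul]
        positivity
      have hGb := aux_G t ht ξ hξ
      rw [← hG] at hGb
      have hl := aux_log t ht ξ z hz hz2
      have hB : 0 < 1 + (ξ * z) ^ 2 := by positivity
      have hc : 1 - Real.cos (ξ * z) ≤ 4 * (ξ * z) ^ 2 / (1 + (ξ * z) ^ 2) := by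
        rw [le_div_iff₀ hB]; exact aux_cos _
      have hP : (1 + (ξ * z) ^ 2) ^ (-(3 / 4) : ℝ) =
          (1 + (ξ * z) ^ 2) ^ (1 / 4 : ℝ) / (1 + (ξ * z) ^ 2) := by
        rw [← Real.rpow_sub_one hB.ne']; norm_num
      rw [hP]
      calc _ ≤ ξ ^ 2 * (4 * (ξ * z) ^ 2 / (1 + (ξ * z) ^ 2)) *
            (36 * ((2 * t + 20) * Real.log (1 / |z|) * (1 + (ξ * z) ^ 2) ^ (1 / 4 : ℝ)) / ξ ^ 4) := by
            apply mul_le_mul _ (hGb.trans _) (hGn ξ) (by positivity)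
            · gcongr
            · gcongr
        _ = _ := by
            rw [sq_abs]
            generalize (1 + (ξ * z) ^ 2) ^ (1 / 4 : ℝ) = P
            field_simp
            ring
  refine key.trans (le_of_eq ?_)
  rw [integral_const_mul, Measure.integral_comp_mul_right (fun y : ℝ => (1 + y ^ 2) ^ (-(3 / 4) : ℝ)) z, abs_inv, smul_eq_mul]
  field_simp
end

section
/- For all real numbers 0 < s < t and all θ ∈ [0, π/2], ∫_0^s ( (t−r)(s−r) )^{-1/2} · [ ∫_0^∞ exp( -ρ²·( cos²θ/(4(t−r)) + sin²θ/(4(s−r)) ) ) dρ ] dr = 2√π · ( √( t·sin²θ + s·cos²θ ) − √(t−s) · sin θ ). -/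
open MeasureTheory Real

/-- Gaussian integral identity from the temporal covariance computation of the
Brownian-time Brownian motion (`β = 1/2`) SPIDE in `d = 2`:
`∫₀^s ((t−r)(s−r))^{-1/2} [∫₀^∞ e^{-ρ²(cos²θ/(4(t−r)) + sin²θ/(4(s−r)))} dρ] dr
  = 2√π (√(t sin²θ + s cos²θ) − √(t−s) sin θ)`. -/
theorem btbm_spide_covariance_gaussian_identity
    (s t θ : ℝ) (hs : 0 < s) (hst : s < t) (hθ0 : 0 ≤ θ) (hθ : θ ≤ π / 2) :
    (∫ r in (0 : ℝ)..s, ((t - r) * (s - r)) ^ (-(1 / 2 : ℝ)) *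
      ∫ ρ in Set.Ioi (0 : ℝ),
        Real.exp (-ρ ^ 2 *
          (Real.cos θ ^ 2 / (4 * (t - r)) + Real.sin θ ^ 2 / (4 * (s - r)))))
      = 2 * Real.sqrt π *
          (Real.sqrt (t * Real.sin θ ^ 2 + s * Real.cos θ ^ 2) -
            Real.sqrt (t - s) * Real.sin θ) := by
  have hsc : Real.sin θ ^ 2 + Real.cos θ ^ 2 = 1 := Real.sin_sq_add_cos_sq θ
  have hsin : 0 ≤ Real.sin θ := Real.sin_nonneg_of_nonneg_of_le_pi hθ0 (by linarith [Real.pi_pos])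
  set C := t * Real.sin θ ^ 2 + s * Real.cos θ ^ 2 with hC
  have hCs : s ≤ C := by nlinarith [sq_nonneg (Real.sin θ)]
  have key : ∀ r ∈ Set.Ioo (0 : ℝ) s,
      HasDerivAt (fun r => -(2 * Real.sqrt π * Real.sqrt (C - r)))
      (((t - r) * (s - r)) ^ (-(1 / 2 : ℝ)) *
      ∫ ρ in Set.Ioi (0 : ℝ),
        Real.exp (-ρ ^ 2 *
          (Real.cos θ ^ 2 / (4 * (t - r)) + Real.sin θ ^ 2 / (4 * (s - r))))) r := by
    intro r hr
    have h1 : 0 < s - r := by linarith [hr.2]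
    have h2 : 0 < t - r := by linarith
    have h3 : 0 < C - r := by linarith
    have hP : 0 < (t - r) * (s - r) := mul_pos h2 h1
    have e1 : (∫ ρ in Set.Ioi (0 : ℝ),
        Real.exp (-ρ ^ 2 *
          (Real.cos θ ^ 2 / (4 * (t - r)) + Real.sin θ ^ 2 / (4 * (s - r)))))
        = Real.sqrt (π / (Real.cos θ ^ 2 / (4 * (t - r)) + Real.sin θ ^ 2 / (4 * (s - r)))) / 2 := by
      rw [← integral_gaussian_Ioi]
      congr 1
      funext ρ
      congr 1
      ring
    have e2 : π / (Real.cos θ ^ 2 / (4 * (t - r)) + Real.sin θ ^ 2 / (4 * (s - r)))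
        = 2 ^ 2 * (((t - r) * (s - r)) * (π / (C - r))) := by
      have : Real.cos θ ^ 2 / (4 * (t - r)) + Real.sin θ ^ 2 / (4 * (s - r))
          = (C - r) / (4 * ((t - r) * (s - r))) := by
        have h4 : C - r = Real.cos θ ^ 2 * (s - r) + Real.sin θ ^ 2 * (t - r) := by
          rw [hC]; linear_combination r * hsc
        rw [h4]; field_simp
      rw [this]; field_simp; norm_num
    rw [e1, e2, Real.sqrt_mul (by norm_num), Real.sqrt_sq (by norm_num), Real.sqrt_mul hP.le,
      Real.rpow_neg hP.le, ← Real.sqrt_eq_rpow, Real.sqrt_div Real.pi_pos.le]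
    have hq : 0 < Real.sqrt ((t - r) * (s - r)) := Real.sqrt_pos.2 hP
    have hc : 0 < Real.sqrt (C - r) := Real.sqrt_pos.2 h3
    have hd := ((((hasDerivAt_id r).const_sub C).sqrt h3.ne').const_mul (2 * Real.sqrt π)).neg
    refine hd.congr_deriv ?_
    simp only [id]
    field_simp
  have hcont : ContinuousOn (fun r => -(2 * Real.sqrt π * Real.sqrt (C - r))) (Set.Icc 0 s) := by
    fun_prop
  have hint := intervalIntegral.integrableOn_deriv_of_nonneg hcont key (by
    intro r hr
    refine mul_nonneg (Real.rpow_nonneg ?_ _) (integral_nonneg fun _ => (Real.exp_pos _).le)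
    exact mul_nonneg (by linarith [hr.2]) (by linarith [hr.2]))
  rw [intervalIntegral.integral_eq_sub_of_hasDerivAt_of_le hs.le hcont key
    ((intervalIntegrable_iff_integrableOn_Ioc_of_le hs.le).2 hint)]
  have h5 : C - s = (t - s) * Real.sin θ ^ 2 := by
    rw [hC]; linear_combination s * hsc
  rw [h5, Real.sqrt_mul (by linarith), Real.sqrt_sq hsin, sub_zero]
  ring
end

section
/- For 0 < s ≤ t define F(s,t) = ∫_0^{π/2} ( √( t·sin²θ + s·cos²θ ) − √(t−s) · sin θ ) / ( sin θ + cos θ ) dθ. Then there is no real constant C such that F(s,t) = C·( √(t+s) − √(t−s) ) for all 0 < s ≤ t. -/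
open MeasureTheory Real

/-- The temporal covariance of the Brownian-time Brownian motion (`β = 1/2`) SPIDE in
`d = 2` is not proportional to the bifractional Brownian motion covariance
`√(t+s) − √(t−s)`: there is no real constant `C` with
`∫₀^{π/2} (√(t sin²θ + s cos²θ) − √(t−s) sin θ)/(sin θ + cos θ) dθ
  = C (√(t+s) − √(t−s))` for all `0 < s ≤ t`. -/
theorem btbm_spide_not_bifractional :
    ¬ ∃ C : ℝ, ∀ s t : ℝ, 0 < s → s ≤ t →
      (∫ θ in (0 : ℝ)..(π / 2),
        (Real.sqrt (t * Real.sin θ ^ 2 + s * Real.cos θ ^ 2) -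
          Real.sqrt (t - s) * Real.sin θ) / (Real.sin θ + Real.cos θ))
        = C * (Real.sqrt (t + s) - Real.sqrt (t - s)) := by
  rintro ⟨C, hC⟩
  obtain ⟨r, hr⟩ : ∃ r, r = Real.exp (-(8 * |C| + 1)) := ⟨_, rfl⟩
  have hr0 : 0 < r := hr ▸ Real.exp_pos _
  have hr1 : r < 1 := by
    rw [hr, Real.exp_lt_one_iff]
    have := abs_nonneg C
    linarith
  have hlog : Real.log r = -(8 * |C| + 1) := by rw [hr, Real.log_exp]
  have hs1 : r ^ 2 < 1 := by nlinarith
  have hs0 : 0 < r ^ 2 := by positivity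
  have h := hC (r ^ 2) 1 hs0 hs1.le
  have hpi := Real.pi_gt_three
  have hden : ∀ θ ∈ Set.Icc (0 : ℝ) (π / 2), 0 < Real.sin θ + Real.cos θ := by
    intro θ hθ
    have h1 : 0 ≤ Real.sin θ := Real.sin_nonneg_of_nonneg_of_le_pi hθ.1 (by linarith [hθ.2])
    have h2 : 0 ≤ Real.cos θ := Real.cos_nonneg_of_mem_Icc ⟨by linarith [hθ.1], hθ.2⟩
    nlinarith [Real.sin_sq_add_cos_sq θ]
  have hI : ∫ θ in (0 : ℝ)..(π / 2), r ^ 2 / 4 * (θ + r)⁻¹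
      = r ^ 2 / 4 * Real.log ((π / 2 + r) / r) := by
    rw [intervalIntegral.integral_const_mul,
      intervalIntegral.integral_comp_add_right (fun x => x⁻¹),
      integral_inv_of_pos (by linarith) (by linarith), zero_add]
  have hmono : ∫ θ in (0 : ℝ)..(π / 2), r ^ 2 / 4 * (θ + r)⁻¹ ≤
      ∫ θ in (0 : ℝ)..(π / 2),
        (Real.sqrt (1 * Real.sin θ ^ 2 + r ^ 2 * Real.cos θ ^ 2) -
          Real.sqrt (1 - r ^ 2) * Real.sin θ) / (Real.sin θ + Real.cos θ) := by
    apply intervalIntegral.integral_mono_on (by linarith)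
    · apply ContinuousOn.intervalIntegrable
      rw [Set.uIcc_of_le (by linarith)]
      refine ContinuousOn.mul (by fun_prop) (ContinuousOn.inv₀ (by fun_prop) ?_)
      intro θ hθ
      linarith [hθ.1]
    · apply ContinuousOn.intervalIntegrable
      rw [Set.uIcc_of_le (by linarith)]
      refine ContinuousOn.div (by fun_prop) (by fun_prop) ?_
      intro θ hθ
      exact (hden θ hθ).ne'
    · intro θ hθ
      have hd := hden θ hθ
      have h1 : 0 ≤ Real.sin θ := Real.sin_nonneg_of_nonneg_of_le_pi hθ.1 (by linarith [hθ.2])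
      have h2 : 0 ≤ Real.cos θ := Real.cos_nonneg_of_mem_Icc ⟨by linarith [hθ.1], hθ.2⟩
      have h3 : Real.sin θ ≤ θ := Real.sin_le hθ.1
      have h4 := Real.sin_le_one θ
      have h5 := Real.cos_le_one θ
      have h6 := Real.sin_sq_add_cos_sq θ
      have hθ0 := hθ.1
      generalize Real.sin θ = S at *
      generalize Real.cos θ = K at *
      have hA2 : Real.sqrt (1 * S ^ 2 + r ^ 2 * K ^ 2) ^ 2 = 1 * S ^ 2 + r ^ 2 * K ^ 2 :=
        Real.sq_sqrt (by positivity)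
      have hA0 : 0 < Real.sqrt (1 * S ^ 2 + r ^ 2 * K ^ 2) := by
        apply Real.sqrt_pos.2
        nlinarith [mul_nonneg (sub_nonneg.2 hs1.le) (sq_nonneg S)]
      have hA : Real.sqrt (1 * S ^ 2 + r ^ 2 * K ^ 2) ≤ S + r := by
        apply Real.sqrt_le_iff.2 ⟨by linarith, ?_⟩
        nlinarith [mul_nonneg hs0.le (sq_nonneg S), mul_nonneg h1 hr0.le]
      have hB2 : Real.sqrt (1 - r ^ 2) ^ 2 = 1 - r ^ 2 := Real.sq_sqrt (by linarith)
      have hB1 : Real.sqrt (1 - r ^ 2) ≤ 1 := Real.sqrt_le_one.2 (by linarith)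
      have hB0 := Real.sqrt_nonneg (1 - r ^ 2)
      generalize Real.sqrt (1 * S ^ 2 + r ^ 2 * K ^ 2) = A at *
      generalize Real.sqrt (1 - r ^ 2) = b at *
      have hbS : b * S ≤ S := by nlinarith
      have hbS0 : 0 ≤ b * S := by positivity
      have key : (A - b * S) * (A + b * S) = r ^ 2 := by
        have : (A - b * S) * (A + b * S) = A ^ 2 - b ^ 2 * S ^ 2 := by ring
        rw [this, hA2, hB2]
        linear_combination r ^ 2 * h6
      have hpos : 0 < A - b * S := by
        by_contra hn
        nlinarith [mul_nonneg (sub_nonneg.2 (not_lt.1 hn)) (by linarith : 0 ≤ A + b * S)]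
      have e : r ^ 2 / 4 * (θ + r)⁻¹ = r ^ 2 / (4 * (θ + r)) := by
        rw [← div_eq_mul_inv, div_div]
      rw [e, div_le_div_iff₀ (by linarith) hd]
      calc r ^ 2 * (S + K) ≤ r ^ 2 * 2 := by gcongr; linarith
        _ = (A - b * S) * (2 * (A + b * S)) := by rw [← key]; ring
        _ ≤ (A - b * S) * (4 * (θ + r)) :=
          mul_le_mul_of_nonneg_left (by linarith) hpos.le
  rw [h, hI] at hmono
  have hl : 8 * |C| + 1 ≤ Real.log ((π / 2 + r) / r) := by
    rw [Real.log_div (by linarith) hr0.ne', hlog]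
    have := Real.log_nonneg (by linarith : 1 ≤ π / 2 + r)
    linarith
  have hX2 : Real.sqrt (1 + r ^ 2) ^ 2 = 1 + r ^ 2 := Real.sq_sqrt (by linarith)
  have hX1 : 1 ≤ Real.sqrt (1 + r ^ 2) := Real.one_le_sqrt.2 (by linarith)
  have hY2 : Real.sqrt (1 - r ^ 2) ^ 2 = 1 - r ^ 2 := Real.sq_sqrt (by linarith)
  have hY0 := Real.sqrt_nonneg (1 - r ^ 2)
  have hXY : Real.sqrt (1 - r ^ 2) ≤ Real.sqrt (1 + r ^ 2) := Real.sqrt_le_sqrt (by linarith)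
  have hD : Real.sqrt (1 + r ^ 2) - Real.sqrt (1 - r ^ 2) ≤ 2 * r ^ 2 := by
    nlinarith
  have hR : C * (Real.sqrt (1 + r ^ 2) - Real.sqrt (1 - r ^ 2)) ≤ |C| * (2 * r ^ 2) :=
    mul_le_mul (le_abs_self C) hD (by linarith) (abs_nonneg C)
  have hL : r ^ 2 / 4 * (8 * |C| + 1) ≤ r ^ 2 / 4 * Real.log ((π / 2 + r) / r) := by gcongr
  nlinarith
end
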